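/- arXiv:1903.08708 — 10 statements merged into one kernel-verified Lean document; each statement's English description precedes it below -/
import Mathlib

section
/- Under the abstract AGBM iteration with momentum parameter satisfying γ ≤ Θ⁴/(4+Θ²), for every M ≥ 1 the training loss satisfies L(f^M) − L★ ≤ (θ_{M−1}²/(2ηγ))·‖f★ − w‖² = 2‖f★ − w‖²/(ηγ(M+1)²). -/
open scoped RealInnerProductSpace
open Finset

/-- The tangent line of a differentiable convex function on `ℝ` lies below its graph. -/
theorem ConvexOn.add_mul_sub_le_of_hasDerivAt {φ : ℝ → ℝ} {d b : ℝ}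
    (hφ : ConvexOn ℝ Set.univ φ) (hd : HasDerivAt φ d b) (a : ℝ) :
    φ b + d * (a - b) ≤ φ a := by
  rcases lt_trichotomy a b with hab | rfl | hab
  · have hs := hφ.slope_le_of_hasDerivAt (Set.mem_univ a) (Set.mem_univ b) hab hd
    rw [slope_def_field, div_le_iff₀ (sub_pos.2 hab)] at hs
    linarith
  · simp
  · have hs := hφ.le_slope_of_hasDerivAt (Set.mem_univ b) (Set.mem_univ a) hab hd
    rw [slope_def_field, le_div_iff₀ (sub_pos.2 hab)] at hs
    linarith

section SeparableLoss

variable {ι : Type*} [Fintype ι] {ℓ ℓ' : ι → ℝ → ℝ} {r g : EuclideanSpace ℝ ι}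

theorem EuclideanSpace.inner_eq_sum_mul (x y : EuclideanSpace ℝ ι) :
    ⟪x, y⟫ = ∑ i, x i * y i := by
  simp [PiLp.inner_apply, mul_comm]

/-- First-order lower bound for a separable convex loss with negative gradient `r` at `g`. -/
theorem sum_loss_sub_inner_le (hderiv : ∀ i x, HasDerivAt (ℓ i) (ℓ' i x) x)
    (hconv : ∀ i, ConvexOn ℝ Set.univ (ℓ i)) (hr : ∀ i, r i = -ℓ' i (g i))
    (u : EuclideanSpace ℝ ι) :
    ∑ i, ℓ i (g i) - ⟪r, u - g⟫ ≤ ∑ i, ℓ i (u i) := by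
  rw [EuclideanSpace.inner_eq_sum_mul, ← sum_sub_distrib]
  refine sum_le_sum fun i _ => ?_
  have hi := (hconv i).add_mul_sub_le_of_hasDerivAt (hderiv i (g i)) (u i)
  rw [hr, PiLp.sub_apply]
  linarith

/-- Quadratic upper bound for a separable smooth loss with negative gradient `r` at `g`. -/
theorem sum_loss_le_sub_inner_add {σ : ℝ}
    (hsmooth : ∀ i a b, ℓ i a ≤ ℓ i b + ℓ' i b * (a - b) + σ / 2 * (a - b) ^ 2)
    (hr : ∀ i, r i = -ℓ' i (g i)) (u : EuclideanSpace ℝ ι) :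
    ∑ i, ℓ i (u i) ≤ ∑ i, ℓ i (g i) - ⟪r, u - g⟫ + σ / 2 * ‖u - g‖ ^ 2 := by
  rw [EuclideanSpace.inner_eq_sum_mul, EuclideanSpace.real_norm_sq_eq, mul_sum,
    ← sum_sub_distrib, ← sum_add_distrib]
  refine sum_le_sum fun i _ => ?_
  have hi := hsmooth i (u i) (g i)
  rw [hr, PiLp.sub_apply]
  linarith

end SeparableLoss

section InnerProduct

variable {E : Type*} [NormedAddCommGroup E] [InnerProductSpace ℝ E]

/-- Decrease of the quadratic model along an approximate gradient step of size `η ≤ 1 / σ`. -/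
theorem neg_inner_smul_add_norm_sq_le {σ η Θ : ℝ} (hη0 : 0 < η) (hησ : σ * η ≤ 1) {b r : E}
    (hb : ‖b - r‖ ^ 2 ≤ (1 - Θ ^ 2) * ‖r‖ ^ 2) :
    -⟪r, η • b⟫ + σ / 2 * ‖η • b‖ ^ 2 ≤ -(η * Θ ^ 2 / 2 * ‖r‖ ^ 2) := by
  have hn : ‖η • b‖ ^ 2 = η ^ 2 * ‖b‖ ^ 2 := by
    rw [norm_smul, mul_pow, Real.norm_eq_abs, sq_abs]
  rw [norm_sub_sq_real, real_inner_comm] at hb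
  rw [inner_smul_right, hn]
  have h1 : σ * η * (η * ‖b‖ ^ 2) ≤ 1 * (η * ‖b‖ ^ 2) := by gcongr
  have h2 := mul_le_mul_of_nonneg_left hb hη0.le
  linarith

/-- Decrease of the distance-plus-error potential under a step `x` whose compression error
contracts by the factor `1 - Θ²`. -/
theorem norm_sq_potential_step {γ Θ : ℝ} (hγ0 : 0 < γ) (hΘ0 : 0 < Θ)
    (hγΘ : γ ≤ Θ ^ 4 / (4 + Θ ^ 2)) {x e e' d : E}
    (he' : ‖e'‖ ^ 2 ≤ (1 - Θ ^ 2) * ‖x + e‖ ^ 2) :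
    2 * ⟪x, d + e⟫ - Θ ^ 2 / γ * ‖x‖ ^ 2 + ‖d - x‖ ^ 2 + ‖e'‖ ^ 2 ≤ ‖d‖ ^ 2 + ‖e‖ ^ 2 := by
  have hΘ2 : 0 < Θ ^ 2 := by positivity
  have hratio : (4 + Θ ^ 2) / Θ ^ 2 ≤ Θ ^ 2 / γ := by
    rw [le_div_iff₀ (by positivity)] at hγΘ
    rw [div_le_div_iff₀ hΘ2 hγ0]
    linarith
  have hx := mul_le_mul_of_nonneg_right hratio (sq_nonneg ‖x‖)
  have hyoung : 2 * (2 - Θ ^ 2) * ⟪x, e⟫ ≤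
      Θ ^ 2 * ‖e‖ ^ 2 + (2 - Θ ^ 2) ^ 2 / Θ ^ 2 * ‖x‖ ^ 2 := by
    have hsq := sq_nonneg ‖Θ • e - ((2 - Θ ^ 2) / Θ) • x‖
    rw [norm_sub_sq_real, norm_smul, norm_smul, mul_pow, mul_pow, Real.norm_eq_abs,
      Real.norm_eq_abs, sq_abs, sq_abs, inner_smul_left, inner_smul_right,
      real_inner_comm, div_pow] at hsq
    have hc : Θ * ((2 - Θ ^ 2) / Θ * ⟪x, e⟫) = (2 - Θ ^ 2) * ⟪x, e⟫ := by field_simp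
    simp only [conj_trivial, hc] at hsq
    linarith
  have hcoef : (2 - Θ ^ 2) ^ 2 / Θ ^ 2 * ‖x‖ ^ 2 =
      (4 + Θ ^ 2) / Θ ^ 2 * ‖x‖ ^ 2 + (Θ ^ 2 - 5) * ‖x‖ ^ 2 := by
    field_simp
    ring
  rw [norm_add_sq_real] at he'
  rw [norm_sub_sq_real, inner_add_right, real_inner_comm x d]
  linarith [sq_nonneg ‖x‖]

end InnerProduct

/-- AGBM convergence rate (Theorem 4.1): under the abstract AGBM iteration with
momentum parameter `γ ≤ Θ⁴/(4+Θ²)`, for every `M ≥ 1`,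
`L(f^M) − L★ ≤ (θ_{M−1}²/(2ηγ))·‖f★ − w‖² = 2‖f★ − w‖²/(ηγ(M+1)²)`. -/
theorem agbm_rate
    (n : ℕ) (hn : 1 ≤ n)
    (σ η γ Θ : ℝ)
    (hσ : 0 < σ) (hη0 : 0 < η) (hη : η ≤ 1 / σ)
    (hγ0 : 0 < γ) (hγ1 : γ ≤ 1) (hΘ0 : 0 < Θ) (hΘ1 : Θ ≤ 1)
    (hγΘ : γ ≤ Θ ^ 4 / (4 + Θ ^ 2))
    (w : EuclideanSpace ℝ (Fin n))
    (ℓ ℓ' : Fin n → ℝ → ℝ)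
    (hderiv : ∀ i x, HasDerivAt (ℓ i) (ℓ' i x) x)
    (hconv : ∀ i, ConvexOn ℝ Set.univ (ℓ i))
    (hsmooth : ∀ i a b, ℓ i a ≤ ℓ i b + ℓ' i b * (a - b) + σ / 2 * (a - b) ^ 2)
    (L : EuclideanSpace ℝ (Fin n) → ℝ)
    (hL : ∀ v, L v = ∑ i, ℓ i (v i))
    (θ α : ℕ → ℝ)
    (hθ : ∀ m : ℕ, θ m = 2 / (m + 2))
    (hα : ∀ m : ℕ, α m = η * γ / θ m)
    (f h hhat g r b1 c b2 : ℕ → EuclideanSpace ℝ (Fin n))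
    (hf0 : f 0 = w) (hh0 : h 0 = w) (hhhat0 : hhat 0 = w)
    (hg : ∀ m, g m = (1 - θ m) • f m + θ m • h m)
    (hr : ∀ m i, r m i = -(ℓ' i (g m i)))
    (hb1 : ∀ m, ‖b1 m - r m‖ ^ 2 ≤ (1 - Θ ^ 2) * ‖r m‖ ^ 2)
    (hfs : ∀ m, f (m + 1) = g m + η • b1 m)
    (hc0 : c 0 = r 0)
    (hcs : ∀ m, 1 ≤ m → c m = r m + (θ m / θ (m - 1)) • (c (m - 1) - b2 (m - 1)))
    (hb2 : ∀ m, ‖b2 m - c m‖ ^ 2 ≤ (1 - Θ ^ 2) * ‖c m‖ ^ 2)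
    (hhs : ∀ m, h (m + 1) = h m + (η * γ / θ m) • b2 m)
    (hhhats : ∀ m, hhat (m + 1) = hhat m + α m • r m)
    (fstar : EuclideanSpace ℝ (Fin n)) (Lstar : ℝ)
    (hmin : ∀ v, L fstar ≤ L v) (hLstar : Lstar = L fstar)
    (M : ℕ) (hM : 1 ≤ M) :
    L (f M) - Lstar ≤ θ (M - 1) ^ 2 / (2 * η * γ) * ‖fstar - w‖ ^ 2 ∧
      θ (M - 1) ^ 2 / (2 * η * γ) * ‖fstar - w‖ ^ 2
        = 2 * ‖fstar - w‖ ^ 2 / (η * γ * ((M : ℝ) + 1) ^ 2) := by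
  have hθpos : ∀ m, 0 < θ m := fun m => by rw [hθ]; positivity
  have hησ : σ * η ≤ 1 := by
    rw [le_div_iff₀ hσ] at hη
    linarith
  have hsmul : ∀ m (v : EuclideanSpace ℝ (Fin n)),
      ‖α m • v‖ ^ 2 = α m ^ 2 * ‖v‖ ^ 2 := fun m v => by
    rw [norm_smul, mul_pow, Real.norm_eq_abs, sq_abs]
  have herr : ∀ m, α m • c m = α m • r m + (hhat m - h m) := by
    intro m
    induction m with
    | zero => simp [hc0, hhhat0, hh0]
    | succ k ih =>
      have hk : α (k + 1) * (θ (k + 1) / θ k) = α k := by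
        rw [hα, hα]
        field_simp [(hθpos k).ne', (hθpos (k + 1)).ne']
      rw [hcs (k + 1) (Nat.le_add_left 1 k), Nat.add_sub_cancel, smul_add, smul_smul, hk,
        smul_sub, ih, hhhats, hhs, ← hα]
      abel
  have hstep : ∀ m, 2 * η * γ / θ m ^ 2 * (L (f (m + 1)) - Lstar) +
      ‖fstar - hhat (m + 1)‖ ^ 2 + ‖hhat (m + 1) - h (m + 1)‖ ^ 2 ≤
      2 * η * γ / θ m ^ 2 * ((1 - θ m) * (L (f m) - Lstar)) +
      ‖fstar - hhat m‖ ^ 2 + ‖hhat m - h m‖ ^ 2 := by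
    intro m
    have hθm := hθpos m
    have hcontr : ‖hhat (m + 1) - h (m + 1)‖ ^ 2 ≤
        (1 - Θ ^ 2) * ‖α m • r m + (hhat m - h m)‖ ^ 2 := by
      have heq : hhat (m + 1) - h (m + 1) = -(α m • (b2 m - c m)) := by
        rw [smul_sub, herr, hhhats, hhs, ← hα]
        abel
      rw [heq, norm_neg, ← herr, hsmul, hsmul]
      linarith [mul_le_mul_of_nonneg_left (hb2 m) (sq_nonneg (α m))]
    have hpot := norm_sq_potential_step hγ0 hΘ0 hγΘ (d := fstar - hhat m) hcontr
    have hdescent : L (f (m + 1)) ≤ L (g m) - η * Θ ^ 2 / 2 * ‖r m‖ ^ 2 := by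
      have hup := sum_loss_le_sub_inner_add hsmooth (hr m) (f (m + 1))
      rw [← hL, ← hL, hfs, add_sub_cancel_left] at hup
      rw [hfs]
      linarith [neg_inner_smul_add_norm_sq_le hη0 hησ (hb1 m)]
    have hlowf := sum_loss_sub_inner_le hderiv hconv (hr m) (f m)
    have hlowstar := sum_loss_sub_inner_le hderiv hconv (hr m) fstar
    rw [← hL, ← hL] at hlowf hlowstar
    have hθ1 : θ m ≤ 1 := by
      rw [hθ, div_le_one (by positivity)]
      linarith [(Nat.cast_nonneg m : (0 : ℝ) ≤ m)]
    have hinner : (1 - θ m) * ⟪r m, f m - g m⟫ + θ m * ⟪r m, fstar - g m⟫ =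
        θ m * ⟪r m, fstar - h m⟫ := by
      rw [← inner_smul_right, ← inner_smul_right, ← inner_smul_right, ← inner_add_right, hg]
      congr 1
      module
    have hmain : L (f (m + 1)) - Lstar ≤ (1 - θ m) * (L (f m) - Lstar) +
        θ m * ⟪r m, fstar - h m⟫ - η * Θ ^ 2 / 2 * ‖r m‖ ^ 2 := by
      have h1 := mul_le_mul_of_nonneg_left hlowf (sub_nonneg.2 hθ1)
      have h2 := mul_le_mul_of_nonneg_left hlowstar hθm.le
      rw [hLstar]
      linarith
    have hscaled := mul_le_mul_of_nonneg_left hmain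
      (show 0 ≤ 2 * η * γ / θ m ^ 2 by positivity)
    have hlin : 2 * η * γ / θ m ^ 2 * (θ m * ⟪r m, fstar - h m⟫) =
        2 * (α m * ⟪r m, fstar - h m⟫) := by
      rw [hα]
      field_simp
    have hquad : 2 * η * γ / θ m ^ 2 * (η * Θ ^ 2 / 2 * ‖r m‖ ^ 2) =
        Θ ^ 2 / γ * (α m ^ 2 * ‖r m‖ ^ 2) := by
      rw [hα]
      field_simp
    rw [sub_add_sub_cancel, real_inner_smul_left, hsmul, sub_sub, ← hhhats] at hpot
    linarith
  have hweight : ∀ m : ℕ, 2 * η * γ / θ m ^ 2 = η * γ * ((m : ℝ) + 2) ^ 2 / 2 := by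
    intro m
    rw [hθ]
    field_simp
  have hgap : ∀ m, 0 ≤ L (f m) - Lstar := fun m => by linarith [hmin (f m)]
  have hpotential : ∀ m : ℕ, 2 * η * γ / θ m ^ 2 * ((1 - θ m) * (L (f m) - Lstar)) +
      ‖fstar - hhat m‖ ^ 2 + ‖hhat m - h m‖ ^ 2 ≤ ‖fstar - w‖ ^ 2 := by
    intro m
    induction m with
    | zero => simp [hθ, hhhat0, hh0]
    | succ k ih =>
      have hcoef : 2 * η * γ / θ (k + 1) ^ 2 * (1 - θ (k + 1)) ≤ 2 * η * γ / θ k ^ 2 := by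
        have heq : 2 * η * γ / θ (k + 1) ^ 2 * (1 - θ (k + 1)) =
            2 * η * γ / θ k ^ 2 - η * γ / 2 := by
          rw [hweight, hweight, hθ]
          push_cast
          field_simp
          ring
        rw [heq]
        linarith [mul_pos hη0 hγ0]
      have hmul := mul_le_mul_of_nonneg_right hcoef (hgap (k + 1))
      rw [mul_assoc] at hmul
      linarith [hstep k]
  obtain ⟨k, rfl⟩ : ∃ k, M = k + 1 := ⟨M - 1, (Nat.sub_add_cancel hM).symm⟩
  rw [Nat.add_sub_cancel]
  constructor
  · have hθk := hθpos k
    have hbound : 2 * η * γ / θ k ^ 2 * (L (f (k + 1)) - Lstar) ≤ ‖fstar - w‖ ^ 2 := by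
      linarith [hstep k, hpotential k, sq_nonneg ‖fstar - hhat (k + 1)‖,
        sq_nonneg ‖hhat (k + 1) - h (k + 1)‖]
    have hscaled := mul_le_mul_of_nonneg_left hbound
      (show 0 ≤ θ k ^ 2 / (2 * η * γ) by positivity)
    have hcancel : θ k ^ 2 / (2 * η * γ) * (2 * η * γ / θ k ^ 2 * (L (f (k + 1)) - Lstar)) =
        L (f (k + 1)) - Lstar := by
      field_simp
    rwa [hcancel] at hscaled
  · rw [hθ]
    push_cast
    field_simp
    ring
end

section
/- Under the abstract AGBM iteration with γ ≤ Θ⁴/(4+Θ²), if additionally each ℓ_i is μ-strongly convex with μ > 0 (so that (μ/2)‖f − f★‖² ≤ L(f) − L★ for all f ∈ ℝⁿ), then for every M ≥ 1: L(f^M) − L★ ≤ (4/(μηγ(M+1)²))·(L(w) − L★). -/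
open scoped RealInnerProductSpace
open Finset

/-- One step of boosting with residual correction: the errors made in the two weak-learner fits are
absorbed by adding the squared distance between `H` and `h` to the usual potential. -/
lemma corrected_step_potential {E : Type*} [NormedAddCommGroup E] [InnerProductSpace ℝ E]
    {η γ Θ θ p Δ Δ' : ℝ} (hη : 0 < η) (hγ : 0 < γ) (hΘ : 0 < Θ) (hθ : 0 < θ)
    (hγΘ : γ * (4 + Θ ^ 2) ≤ Θ ^ 4) (hp : p * θ = η * γ)
    {h H r c b x : E} (hc : p • c = p • r + (H - h))
    (hb : ‖b - c‖ ^ 2 ≤ (1 - Θ ^ 2) * ‖c‖ ^ 2)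
    (hΔ : Δ' ≤ (1 - θ) * Δ + θ * ⟪r, x - h⟫ - η * Θ ^ 2 / 2 * ‖r‖ ^ 2) :
    2 * p * Δ' + θ * (‖x - (H + p • r)‖ ^ 2 + ‖(H + p • r) - (h + p • b)‖ ^ 2) ≤
      2 * p * ((1 - θ) * Δ) + θ * (‖x - H‖ ^ 2 + ‖H - h‖ ^ 2) := by
  have hp0 : 0 < p := by
    by_contra! hneg
    nlinarith [mul_pos hη hγ]
  have herr : ‖(H + p • r) - (h + p • b)‖ ^ 2 ≤
      (1 - Θ ^ 2) * (p ^ 2 * ‖r‖ ^ 2 + 2 * p * ⟪r, H - h⟫ + ‖H - h‖ ^ 2) := by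
    have hvec : (H + p • r) - (h + p • b) = -(p • (b - c)) := by
      rw [smul_sub, hc]; abel
    have hcn : p ^ 2 * ‖c‖ ^ 2 = p ^ 2 * ‖r‖ ^ 2 + 2 * p * ⟪r, H - h⟫ + ‖H - h‖ ^ 2 := by
      have hsq := congrArg (fun v => ‖v‖ ^ 2) hc
      simp only [norm_add_sq_real, norm_smul, inner_smul_left, mul_pow, Real.norm_eq_abs,
        sq_abs, conj_trivial] at hsq
      linarith
    rw [hvec, norm_neg, norm_smul, mul_pow, Real.norm_eq_abs, sq_abs, ← hcn]
    nlinarith [sq_nonneg p]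
  have hdist : ‖x - (H + p • r)‖ ^ 2 =
      ‖x - H‖ ^ 2 - 2 * p * ⟪r, x - H⟫ + p ^ 2 * ‖r‖ ^ 2 := by
    rw [← sub_sub, norm_sub_sq_real, inner_smul_right, real_inner_comm, norm_smul, mul_pow,
      Real.norm_eq_abs, sq_abs]
    ring
  have hsplit : ⟪r, x - h⟫ = ⟪r, x - H⟫ + ⟪r, H - h⟫ := by
    rw [← inner_add_right]; congr 1; abel
  have hsquare : 0 ≤ (2 - Θ ^ 2) ^ 2 * (p ^ 2 * ‖r‖ ^ 2) -
      2 * (Θ ^ 2 * (2 - Θ ^ 2)) * (p * ⟪r, H - h⟫) + Θ ^ 4 * ‖H - h‖ ^ 2 := by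
    have hnn := sq_nonneg ‖((2 - Θ ^ 2) * p) • r - (Θ ^ 2) • (H - h)‖
    rw [norm_sub_sq_real, inner_smul_left, inner_smul_right, norm_smul, norm_smul, mul_pow,
      mul_pow, Real.norm_eq_abs, Real.norm_eq_abs, sq_abs, sq_abs, conj_trivial] at hnn
    linarith
  have hη' : η = p * θ / γ := by field_simp; linarith
  have hΘ2 : 0 < Θ ^ 2 := by positivity
  have hcoef : 2 * (2 - Θ ^ 2) / Θ ^ 2 ≤ Θ ^ 2 / γ := by
    rw [div_le_div_iff₀ hΘ2 hγ]; nlinarith [mul_pos hγ hΘ2]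
  have hquad : (2 - Θ ^ 2) * (p ^ 2 * ‖r‖ ^ 2) + 2 * (2 - Θ ^ 2) * (p * ⟪r, H - h⟫) -
      Θ ^ 2 * ‖H - h‖ ^ 2 ≤ Θ ^ 2 / γ * (p ^ 2 * ‖r‖ ^ 2) := by
    refine le_trans ?_ (mul_le_mul_of_nonneg_right hcoef (by positivity))
    rw [div_mul_eq_mul_div, le_div_iff₀ hΘ2]
    linarith
  have hmain := mul_le_mul_of_nonneg_left hΔ (by positivity : 0 ≤ 2 * p)
  have hdesc : 2 * p * (η * Θ ^ 2 / 2 * ‖r‖ ^ 2) = θ * (Θ ^ 2 / γ * (p ^ 2 * ‖r‖ ^ 2)) := by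
    rw [hη']; ring
  have herr' := mul_le_mul_of_nonneg_left herr hθ.le
  have hquad' := mul_le_mul_of_nonneg_left hquad hθ.le
  rw [hdist, hsplit] at *
  linarith

/-- A first-order expansion of each coordinate loss sums to one of the separable loss. -/
lemma separable_expansion {n : ℕ} {ℓ ℓ' : Fin n → ℝ → ℝ} {u v r : EuclideanSpace ℝ (Fin n)}
    (K : ℝ) (hr : ∀ i, r i = -(ℓ' i (v i))) :
    ∑ i, (ℓ i (v i) + ℓ' i (v i) * (u i - v i) + K * (u i - v i) ^ 2) =
      ∑ i, ℓ i (v i) - ⟪r, u - v⟫ + K * ‖u - v‖ ^ 2 := by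
  simp only [EuclideanSpace.norm_sq_eq, PiLp.inner_apply, sum_add_distrib, mul_sum,
    PiLp.sub_apply, Real.norm_eq_abs, sq_abs, hr]
  rw [sub_eq_add_neg, ← sum_neg_distrib]
  congr 2
  refine sum_congr rfl fun i _ => ?_
  simp [mul_comm]

/-- AGBM with strong convexity: under the abstract AGBM iteration with
`γ ≤ Θ⁴/(4+Θ²)`, if each `ℓᵢ` is `μ`-strongly convex (`μ > 0`), then for all `M ≥ 1`,
`L(f^M) − L★ ≤ (4/(μηγ(M+1)²))·(L(w) − L★)`. -/
theorem agbm_rate_strongly_convex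
    (n : ℕ) (hn : 1 ≤ n)
    (σ η γ Θ : ℝ)
    (hσ : 0 < σ) (hη0 : 0 < η) (hη : η ≤ 1 / σ)
    (hγ0 : 0 < γ) (hγ1 : γ ≤ 1) (hΘ0 : 0 < Θ) (hΘ1 : Θ ≤ 1)
    (w : EuclideanSpace ℝ (Fin n))
    (ℓ ℓ' : Fin n → ℝ → ℝ)
    (hderiv : ∀ i x, HasDerivAt (ℓ i) (ℓ' i x) x)
    (hconv : ∀ i, ConvexOn ℝ Set.univ (ℓ i))
    (hsmooth : ∀ i a b, ℓ i a ≤ ℓ i b + ℓ' i b * (a - b) + σ / 2 * (a - b) ^ 2)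
    (L : EuclideanSpace ℝ (Fin n) → ℝ)
    (hL : ∀ v, L v = ∑ i, ℓ i (v i))
    (θ α : ℕ → ℝ)
    (hθ : ∀ m : ℕ, θ m = 2 / (m + 2))
    (hα : ∀ m : ℕ, α m = η * γ / θ m)
    (f h hhat g r b1 c b2 : ℕ → EuclideanSpace ℝ (Fin n))
    (hf0 : f 0 = w) (hh0 : h 0 = w) (hhhat0 : hhat 0 = w)
    (hg : ∀ m, g m = (1 - θ m) • f m + θ m • h m)
    (hr : ∀ m i, r m i = -(ℓ' i (g m i)))
    (hb1 : ∀ m, ‖b1 m - r m‖ ^ 2 ≤ (1 - Θ ^ 2) * ‖r m‖ ^ 2)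
    (hfs : ∀ m, f (m + 1) = g m + η • b1 m)
    (hc0 : c 0 = r 0)
    (hcs : ∀ m, 1 ≤ m → c m = r m + (θ m / θ (m - 1)) • (c (m - 1) - b2 (m - 1)))
    (hb2 : ∀ m, ‖b2 m - c m‖ ^ 2 ≤ (1 - Θ ^ 2) * ‖c m‖ ^ 2)
    (hhs : ∀ m, h (m + 1) = h m + (η * γ / θ m) • b2 m)
    (hhhats : ∀ m, hhat (m + 1) = hhat m + α m • r m)
    (hγΘ : γ ≤ Θ ^ 4 / (4 + Θ ^ 2))
    (μ : ℝ) (hμ : 0 < μ)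
    (hstrong : ∀ i a b, ℓ i b + ℓ' i b * (a - b) + μ / 2 * (a - b) ^ 2 ≤ ℓ i a)
    (fstar : EuclideanSpace ℝ (Fin n)) (Lstar : ℝ)
    (hmin : ∀ v, L fstar ≤ L v) (hLstar : Lstar = L fstar)
    (M : ℕ) (hM : 1 ≤ M) :
    L (f M) - Lstar ≤ 4 / (μ * η * γ * ((M : ℝ) + 1) ^ 2) * (L w - Lstar) := by
  have hupper : ∀ u v r : EuclideanSpace ℝ (Fin n), (∀ i, r i = -(ℓ' i (v i))) →
      L u ≤ L v - ⟪r, u - v⟫ + σ / 2 * ‖u - v‖ ^ 2 := by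
    intro u v r hr
    rw [hL, hL, ← separable_expansion (σ / 2) hr]
    exact sum_le_sum fun i _ => hsmooth i _ _
  have hlower : ∀ u v r : EuclideanSpace ℝ (Fin n), (∀ i, r i = -(ℓ' i (v i))) →
      L v - ⟪r, u - v⟫ + μ / 2 * ‖u - v‖ ^ 2 ≤ L u := by
    intro u v r hr
    rw [hL, hL, ← separable_expansion (μ / 2) hr]
    exact sum_le_sum fun i _ => hstrong i _ _
  have hση : σ * η ≤ 1 := by
    rw [le_div_iff₀ hσ] at hη; linarith
  have hgap : μ / 2 * ‖fstar - w‖ ^ 2 ≤ L w - Lstar := by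
    let ρ : EuclideanSpace ℝ (Fin n) := WithLp.toLp 2 fun i => -(ℓ' i (fstar i))
    have hρ : ∀ i, ρ i = -(ℓ' i (fstar i)) := fun i => rfl
    have hstep := hupper (fstar + (1 / σ) • ρ) fstar ρ hρ
    rw [add_sub_cancel_left, inner_smul_right, real_inner_self_eq_norm_sq, norm_smul, mul_pow,
      Real.norm_eq_abs, sq_abs] at hstep
    have hexp : σ / 2 * ((1 / σ) ^ 2 * ‖ρ‖ ^ 2) = 1 / σ * ‖ρ‖ ^ 2 / 2 := by field_simp
    have hsmall : 1 / σ * ‖ρ‖ ^ 2 ≤ 0 := by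
      have := hmin (fstar + (1 / σ) • ρ)
      linarith
    have hρ0 : ρ = 0 := by
      have : ‖ρ‖ ^ 2 ≤ 0 := nonpos_of_mul_nonpos_right hsmall (by positivity)
      exact norm_eq_zero.mp (pow_eq_zero_iff two_ne_zero |>.mp (le_antisymm this (sq_nonneg _)))
    have := hlower w fstar ρ hρ
    rw [hρ0, inner_zero_left, norm_sub_rev] at this
    linarith
  have hθpos : ∀ m, 0 < θ m := fun m => by rw [hθ]; positivity
  have hθ1 : ∀ m, θ m ≤ 1 := fun m => by
    rw [hθ, div_le_one (by positivity)]
    linarith [(Nat.cast_nonneg m : (0 : ℝ) ≤ m)]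
  have hαθ : ∀ m, α m * θ m = η * γ := fun m => by
    rw [hα, div_mul_cancel₀ _ (hθpos m).ne']
  have hhs' : ∀ m, h (m + 1) = h m + α m • b2 m := fun m => by rw [hhs, hα]
  have hcorr : ∀ m, α m • c m = α m • r m + (hhat m - h m) := by
    intro m
    induction m with
    | zero => rw [hc0, hh0, hhhat0, sub_self, add_zero]
    | succ k ih =>
      have hratio : α (k + 1) * (θ (k + 1) / θ k) = α k := by
        rw [← mul_div_assoc, hαθ, hα]
      rw [hcs (k + 1) (by omega), Nat.add_sub_cancel, smul_add, smul_smul, hratio, smul_sub, ih,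
        hhhats, hhs']
      abel
  have hdescent : ∀ m, L (f (m + 1)) - Lstar ≤ (1 - θ m) * (L (f m) - Lstar) +
      θ m * ⟪r m, fstar - h m⟫ - η * Θ ^ 2 / 2 * ‖r m‖ ^ 2 := by
    intro m
    have hdec : L (f (m + 1)) ≤ L (g m) - η * Θ ^ 2 / 2 * ‖r m‖ ^ 2 := by
      have hs := hupper (f (m + 1)) (g m) (r m) (hr m)
      rw [hfs, add_sub_cancel_left, inner_smul_right, norm_smul, mul_pow, Real.norm_eq_abs,
        sq_abs] at hs
      have hb := hb1 m
      rw [norm_sub_sq_real, real_inner_comm] at hb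
      have hq : σ / 2 * (η ^ 2 * ‖b1 m‖ ^ 2) ≤ η / 2 * ‖b1 m‖ ^ 2 := by
        have := mul_le_mul_of_nonneg_right hση (by positivity : 0 ≤ η / 2 * ‖b1 m‖ ^ 2)
        linarith
      have hb' := mul_le_mul_of_nonneg_left hb (by positivity : 0 ≤ η / 2)
      rw [hfs]
      linarith
    have hlf : L (g m) - ⟪r m, f m - g m⟫ ≤ L (f m) := by
      have := hlower (f m) (g m) (r m) (hr m)
      nlinarith [sq_nonneg ‖f m - g m‖]
    have hls : L (g m) - ⟪r m, fstar - g m⟫ ≤ Lstar := by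
      have := hlower fstar (g m) (r m) (hr m)
      nlinarith [sq_nonneg ‖fstar - g m‖]
    have hcomb : (1 - θ m) * ⟪r m, f m - g m⟫ + θ m * ⟪r m, fstar - g m⟫ =
        θ m * ⟪r m, fstar - h m⟫ := by
      rw [← inner_smul_right, ← inner_smul_right, ← inner_smul_right, ← inner_add_right]
      congr 1
      rw [hg]
      module
    have h1 := mul_le_mul_of_nonneg_left hlf (sub_nonneg.mpr (hθ1 m))
    have h2 := mul_le_mul_of_nonneg_left hls (hθpos m).le
    linarith
  have hγΘ' : γ * (4 + Θ ^ 2) ≤ Θ ^ 4 := by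
    rwa [le_div_iff₀ (by positivity)] at hγΘ
  have hstep : ∀ m : ℕ, η * γ * ((m + 2 : ℝ) ^ 2 / 2) * (L (f (m + 1)) - Lstar) +
      (‖fstar - hhat (m + 1)‖ ^ 2 + ‖hhat (m + 1) - h (m + 1)‖ ^ 2) ≤
      η * γ * (m * (m + 2 : ℝ) / 2) * (L (f m) - Lstar) +
      (‖fstar - hhat m‖ ^ 2 + ‖hhat m - h m‖ ^ 2) := by
    intro m
    have hs := corrected_step_potential hη0 hγ0 hΘ0 (hθpos m) hγΘ' (hαθ m) (hcorr m) (hb2 m)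
      (hdescent m)
    rw [← hhhats, ← hhs'] at hs
    refine le_of_mul_le_mul_left ?_ (hθpos m)
    have hα' : α m = η * γ * (m + 2) / 2 := by rw [hα, hθ]; field_simp
    have e1 : θ m * (η * γ * ((m + 2 : ℝ) ^ 2 / 2)) = 2 * α m := by
      rw [hα', hθ]; field_simp
    have e2 : θ m * (η * γ * (m * (m + 2 : ℝ) / 2)) = 2 * α m * (1 - θ m) := by
      rw [hα', hθ]; field_simp; ring
    linear_combination hs + (L (f (m + 1)) - Lstar) * e1 - (L (f m) - Lstar) * e2
  have hnonneg : ∀ m, 0 ≤ L (f m) - Lstar := fun m => by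
    rw [hLstar]; exact sub_nonneg.mpr (hmin _)
  have hpot : ∀ m : ℕ, η * γ * ((m + 2 : ℝ) ^ 2 / 2) * (L (f (m + 1)) - Lstar) +
      (‖fstar - hhat (m + 1)‖ ^ 2 + ‖hhat (m + 1) - h (m + 1)‖ ^ 2) ≤ ‖fstar - w‖ ^ 2 := by
    intro m
    induction m with
    | zero => simpa [hhhat0, hh0] using hstep 0
    | succ k ih =>
      refine (hstep (k + 1)).trans (le_trans ?_ ih)
      push_cast
      have := mul_nonneg (mul_pos hη0 hγ0).le (hnonneg (k + 1))
      nlinarith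
  obtain ⟨k, rfl⟩ : ∃ k, M = k + 1 := ⟨M - 1, by omega⟩
  have hk := hpot k
  have hbound : η * γ * ((k + 2 : ℝ) ^ 2 / 2) * (L (f (k + 1)) - Lstar) ≤ ‖fstar - w‖ ^ 2 := by
    linarith [sq_nonneg ‖fstar - hhat (k + 1)‖, sq_nonneg ‖hhat (k + 1) - h (k + 1)‖]
  have hfinal := mul_le_mul_of_nonneg_left hbound (by positivity : 0 ≤ μ / 2)
  push_cast
  rw [show (k : ℝ) + 1 + 1 = k + 2 by ring, div_mul_eq_mul_div, le_div_iff₀ (by positivity)]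
  linarith
end

section
/- Under the abstract AGBM iteration with γ ≤ Θ⁴/(4+Θ²), if additionally each ℓ_i is μ-strongly convex with μ > 0, and the number of inner iterations M ≥ 1 satisfies (M+1)² ≥ 8/(ηγμ), then one stage of the restarted algorithm halves the optimality gap: L(f^M) − L★ ≤ (1/2)·(L(w) − L★), where w is the initialization of the stage. -/
open scoped RealInnerProductSpace
open Finset

section Lemmas

variable {E : Type*} [NormedAddCommGroup E] [InnerProductSpace ℝ E]

/-- A relative error bound on the approximation `b` of `r` bounds the quadratic model below. -/
lemma mul_norm_sq_le_of_norm_sub_sq_le {T : ℝ} {b r : E}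
    (hb : ‖b - r‖ ^ 2 ≤ (1 - T) * ‖r‖ ^ 2) :
    T * ‖r‖ ^ 2 ≤ 2 * ⟪r, b⟫ - ‖b‖ ^ 2 := by
  rw [norm_sub_sq_real, real_inner_comm] at hb
  linarith

/-- Sufficient decrease of an inexact gradient step. -/
lemma inexact_gradient_step {L : E → ℝ} {σ η T : ℝ} (hσ : 0 < σ) (hη0 : 0 < η)
    (hη : η ≤ 1 / σ) {g r b : E}
    (hsmooth : ∀ x, L x ≤ L g - ⟪r, x - g⟫ + σ / 2 * ‖x - g‖ ^ 2)
    (hb : ‖b - r‖ ^ 2 ≤ (1 - T) * ‖r‖ ^ 2) :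
    L (g + η • b) ≤ L g - η * T / 2 * ‖r‖ ^ 2 := by
  have h1 := hsmooth (g + η • b)
  rw [add_sub_cancel_left, real_inner_smul_right, norm_smul, mul_pow, Real.norm_eq_abs,
    sq_abs] at h1
  have h2 := mul_norm_sq_le_of_norm_sub_sq_le hb
  have h3 : η * σ ≤ 1 := by rwa [le_div_iff₀ hσ] at hη
  have h4 : σ / 2 * (η ^ 2 * ‖b‖ ^ 2) ≤ η / 2 * ‖b‖ ^ 2 := by
    have := mul_le_mul_of_nonneg_right h3 (by positivity : 0 ≤ η / 2 * ‖b‖ ^ 2)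
    linarith
  have h5 := mul_le_mul_of_nonneg_left h2 (by positivity : 0 ≤ η / 2)
  linarith

/-- The error-feedback term is absorbed by the sufficient decrease. -/
lemma error_feedback_absorbed {γ T : ℝ} (hγ : 0 < γ) (hT : 0 < T)
    (hγT : γ * (4 + T) ≤ T ^ 2) (s d : E) :
    2 * ⟪s, d⟫ + ‖s‖ ^ 2 + (1 - T) * ‖d + s‖ ^ 2 ≤ T / γ * ‖s‖ ^ 2 + ‖d‖ ^ 2 := by
  have h1 : 0 ≤ ‖T • d - (2 - T) • s‖ ^ 2 := by positivity
  rw [norm_sub_sq_real, norm_smul, norm_smul, mul_pow, mul_pow, Real.norm_eq_abs,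
    Real.norm_eq_abs, sq_abs, sq_abs, real_inner_smul_left, real_inner_smul_right] at h1
  rw [norm_add_sq_real, real_inner_comm d s]
  have h2 : (4 + T) * ‖s‖ ^ 2 ≤ T * (T / γ * ‖s‖ ^ 2) := by
    have : 4 + T ≤ T ^ 2 / γ := by rw [le_div_iff₀ hγ]; linarith
    calc (4 + T) * ‖s‖ ^ 2 ≤ T ^ 2 / γ * ‖s‖ ^ 2 := by gcongr
      _ = _ := by ring
  have h3 : 0 ≤ T * ‖s‖ ^ 2 := by positivity
  refine le_of_mul_le_mul_left ?_ hT
  linarith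

/-- One step of the accelerated method with error feedback decreases the potential. -/
lemma agbm_potential_step {L : E → ℝ} {σ η γ T t α : ℝ} (hσ : 0 < σ) (hη0 : 0 < η)
    (hη : η ≤ 1 / σ) (hγ : 0 < γ) (hT0 : 0 < T) (hγT : γ * (4 + T) ≤ T ^ 2)
    (ht0 : 0 < t) (ht1 : t ≤ 1) (hα : α = η * γ / t) {f h hhat g r b c b' x : E}
    (hg : g = (1 - t) • f + t • h)
    (hsmooth : ∀ y, L y ≤ L g - ⟪r, y - g⟫ + σ / 2 * ‖y - g‖ ^ 2)
    (hconv : ∀ y, L g - ⟪r, y - g⟫ ≤ L y)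
    (hb : ‖b - r‖ ^ 2 ≤ (1 - T) * ‖r‖ ^ 2)
    (hc : hhat - h + α • r = α • c)
    (hb' : ‖b' - c‖ ^ 2 ≤ (1 - T) * ‖c‖ ^ 2) :
    2 * (η * γ) / t ^ 2 * (L (g + η • b) - L x) + ‖x - (hhat + α • r)‖ ^ 2
        + ‖(hhat + α • r) - (h + α • b')‖ ^ 2
      ≤ 2 * (η * γ) * ((1 - t) / t ^ 2) * (L f - L x) + ‖x - hhat‖ ^ 2
        + ‖hhat - h‖ ^ 2 := by
  have hα0 : 0 < α := by rw [hα]; positivity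
  have hdec := inexact_gradient_step hσ hη0 hη hsmooth hb
  have hlin : L g ≤ (1 - t) * L f + t * L x + t * ⟪r, x - h⟫ := by
    have h1 := mul_le_mul_of_nonneg_left (hconv f) (sub_nonneg.2 ht1)
    have h2 := mul_le_mul_of_nonneg_left (hconv x) ht0.le
    have h3 : (1 - t) * ⟪r, f - g⟫ + t * ⟪r, x - g⟫ = t * ⟪r, x - h⟫ := by
      rw [hg]
      simp only [inner_sub_right, inner_add_right, real_inner_smul_right]
      ring
    linarith
  have hdist : ‖x - (hhat + α • r)‖ ^ 2
      = ‖x - hhat‖ ^ 2 - 2 * α * ⟪r, x - hhat⟫ + ‖α • r‖ ^ 2 := by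
    rw [← sub_sub, norm_sub_sq_real, real_inner_smul_right, real_inner_comm]
    ring
  have herr : ‖(hhat + α • r) - (h + α • b')‖ ^ 2 ≤ (1 - T) * ‖hhat - h + α • r‖ ^ 2 := by
    have : (hhat + α • r) - (h + α • b') = α • (c - b') := by
      rw [smul_sub, ← hc]; abel
    rw [this, hc, norm_smul, norm_smul, mul_pow, mul_pow, norm_sub_rev]
    have := mul_le_mul_of_nonneg_left hb' (sq_nonneg ‖α‖)
    linarith
  have habs := error_feedback_absorbed hγ hT0 hγT (α • r) (hhat - h)
  have hsplit : α * ⟪r, x - h⟫ = α * ⟪r, x - hhat⟫ + ⟪α • r, hhat - h⟫ := by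
    rw [real_inner_smul_left, ← mul_add, ← inner_add_right, sub_add_sub_cancel]
  have hscale : 2 * (η * γ) / t ^ 2 * (η * T / 2 * ‖r‖ ^ 2) = T / γ * ‖α • r‖ ^ 2 := by
    rw [norm_smul, mul_pow, Real.norm_eq_abs, sq_abs, hα]
    field_simp
  have hmain : 2 * (η * γ) / t ^ 2 * (L (g + η • b) - L x)
      ≤ 2 * (η * γ) / t ^ 2 *
        ((1 - t) * (L f - L x) + t * ⟪r, x - h⟫ - η * T / 2 * ‖r‖ ^ 2) := by
    refine mul_le_mul_of_nonneg_left ?_ (by positivity)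
    linarith
  have hexp : 2 * (η * γ) / t ^ 2 *
        ((1 - t) * (L f - L x) + t * ⟪r, x - h⟫ - η * T / 2 * ‖r‖ ^ 2)
      = 2 * (η * γ) * ((1 - t) / t ^ 2) * (L f - L x) + 2 * (α * ⟪r, x - h⟫)
        - T / γ * ‖α • r‖ ^ 2 := by
    rw [mul_sub, hscale, hα]
    field_simp
  linarith

end Lemmas

section Separable

variable {n : ℕ} {ℓ ℓ' : Fin n → ℝ → ℝ} {L : EuclideanSpace ℝ (Fin n) → ℝ}

lemma separable_quadratic_model (hL : ∀ v, L v = ∑ i, ℓ i (v i)) (κ : ℝ)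
    {r g : EuclideanSpace ℝ (Fin n)} (hr : ∀ i, r i = -(ℓ' i (g i)))
    (x : EuclideanSpace ℝ (Fin n)) :
    L g - ⟪r, x - g⟫ + κ / 2 * ‖x - g‖ ^ 2
      = ∑ i, (ℓ i (g i) + ℓ' i (g i) * (x i - g i) + κ / 2 * (x i - g i) ^ 2) := by
  rw [hL, EuclideanSpace.real_norm_sq_eq, PiLp.inner_apply, Finset.mul_sum,
    ← Finset.sum_sub_distrib, ← Finset.sum_add_distrib]
  refine Finset.sum_congr rfl fun i _ => ?_
  simp only [PiLp.sub_apply, hr, RCLike.inner_apply, conj_trivial]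
  ring

lemma separable_smooth_upper (hL : ∀ v, L v = ∑ i, ℓ i (v i)) {σ : ℝ}
    (hsmooth : ∀ i a b, ℓ i a ≤ ℓ i b + ℓ' i b * (a - b) + σ / 2 * (a - b) ^ 2)
    {r g : EuclideanSpace ℝ (Fin n)} (hr : ∀ i, r i = -(ℓ' i (g i)))
    (x : EuclideanSpace ℝ (Fin n)) :
    L x ≤ L g - ⟪r, x - g⟫ + σ / 2 * ‖x - g‖ ^ 2 := by
  rw [separable_quadratic_model hL σ hr, hL]
  exact Finset.sum_le_sum fun i _ => hsmooth i _ _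

lemma separable_strongly_convex_lower (hL : ∀ v, L v = ∑ i, ℓ i (v i)) {μ : ℝ}
    (hstrong : ∀ i a b, ℓ i b + ℓ' i b * (a - b) + μ / 2 * (a - b) ^ 2 ≤ ℓ i a)
    {r g : EuclideanSpace ℝ (Fin n)} (hr : ∀ i, r i = -(ℓ' i (g i)))
    (x : EuclideanSpace ℝ (Fin n)) :
    L g - ⟪r, x - g⟫ + μ / 2 * ‖x - g‖ ^ 2 ≤ L x := by
  rw [separable_quadratic_model hL μ hr, hL]
  exact Finset.sum_le_sum fun i _ => hstrong i _ _

lemma quadratic_growth_of_isMin (hL : ∀ v, L v = ∑ i, ℓ i (v i)) {σ μ : ℝ} (hσ : 0 < σ)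
    (hsmooth : ∀ i a b, ℓ i a ≤ ℓ i b + ℓ' i b * (a - b) + σ / 2 * (a - b) ^ 2)
    (hstrong : ∀ i a b, ℓ i b + ℓ' i b * (a - b) + μ / 2 * (a - b) ^ 2 ≤ ℓ i a)
    {z : EuclideanSpace ℝ (Fin n)} (hmin : ∀ v, L z ≤ L v)
    (x : EuclideanSpace ℝ (Fin n)) :
    μ / 2 * ‖x - z‖ ^ 2 ≤ L x - L z := by
  set r : EuclideanSpace ℝ (Fin n) := WithLp.toLp 2 fun i => -(ℓ' i (z i))
  have hr : ∀ i, r i = -(ℓ' i (z i)) := fun i => rfl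
  have hdec := inexact_gradient_step (L := L) (T := 1) hσ (one_div_pos.2 hσ) le_rfl
    (b := r) (separable_smooth_upper hL hsmooth hr) (by simp)
  have hle : 1 / σ * 1 / 2 * ‖r‖ ^ 2 ≤ 0 := by linarith [hmin (z + (1 / σ) • r)]
  have hr0 : r = 0 := by
    by_contra hne
    have : 0 < ‖r‖ := norm_pos_iff.2 hne
    exact absurd hle (not_le.2 (by positivity))
  have hlow := separable_strongly_convex_lower hL hstrong hr x
  rw [hr0, inner_zero_left] at hlow
  linarith

end Separable

/-- One stage of restarted AGBM halves the optimality gap: if additionally each `ℓᵢ`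
is `μ`-strongly convex and `(M+1)² ≥ 8/(ηγμ)`, then `L(f^M) − L★ ≤ (1/2)(L(w) − L★)`. -/
theorem agbm_restart_halves_gap
    (n : ℕ) (hn : 1 ≤ n)
    (σ η γ Θ : ℝ)
    (hσ : 0 < σ) (hη0 : 0 < η) (hη : η ≤ 1 / σ)
    (hγ0 : 0 < γ) (hγ1 : γ ≤ 1) (hΘ0 : 0 < Θ) (hΘ1 : Θ ≤ 1)
    (w : EuclideanSpace ℝ (Fin n))
    (ℓ ℓ' : Fin n → ℝ → ℝ)
    (hderiv : ∀ i x, HasDerivAt (ℓ i) (ℓ' i x) x)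
    (hconv : ∀ i, ConvexOn ℝ Set.univ (ℓ i))
    (hsmooth : ∀ i a b, ℓ i a ≤ ℓ i b + ℓ' i b * (a - b) + σ / 2 * (a - b) ^ 2)
    (L : EuclideanSpace ℝ (Fin n) → ℝ)
    (hL : ∀ v, L v = ∑ i, ℓ i (v i))
    (θ α : ℕ → ℝ)
    (hθ : ∀ m : ℕ, θ m = 2 / (m + 2))
    (hα : ∀ m : ℕ, α m = η * γ / θ m)
    (f h hhat g r b1 c b2 : ℕ → EuclideanSpace ℝ (Fin n))
    (hf0 : f 0 = w) (hh0 : h 0 = w) (hhhat0 : hhat 0 = w)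
    (hg : ∀ m, g m = (1 - θ m) • f m + θ m • h m)
    (hr : ∀ m i, r m i = -(ℓ' i (g m i)))
    (hb1 : ∀ m, ‖b1 m - r m‖ ^ 2 ≤ (1 - Θ ^ 2) * ‖r m‖ ^ 2)
    (hfs : ∀ m, f (m + 1) = g m + η • b1 m)
    (hc0 : c 0 = r 0)
    (hcs : ∀ m, 1 ≤ m → c m = r m + (θ m / θ (m - 1)) • (c (m - 1) - b2 (m - 1)))
    (hb2 : ∀ m, ‖b2 m - c m‖ ^ 2 ≤ (1 - Θ ^ 2) * ‖c m‖ ^ 2)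
    (hhs : ∀ m, h (m + 1) = h m + (η * γ / θ m) • b2 m)
    (hhhats : ∀ m, hhat (m + 1) = hhat m + α m • r m)
    (hγΘ : γ ≤ Θ ^ 4 / (4 + Θ ^ 2))
    (μ : ℝ) (hμ : 0 < μ)
    (hstrong : ∀ i a b, ℓ i b + ℓ' i b * (a - b) + μ / 2 * (a - b) ^ 2 ≤ ℓ i a)
    (fstar : EuclideanSpace ℝ (Fin n)) (Lstar : ℝ)
    (hmin : ∀ v, L fstar ≤ L v) (hLstar : Lstar = L fstar)
    (M : ℕ) (hM : 1 ≤ M)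
    (hMiter : 8 / (η * γ * μ) ≤ ((M : ℝ) + 1) ^ 2) :
    L (f M) - Lstar ≤ (1 / 2) * (L w - Lstar) := by
  have hT0 : 0 < Θ ^ 2 := by positivity
  have hγT : γ * (4 + Θ ^ 2) ≤ (Θ ^ 2) ^ 2 := by
    rw [le_div_iff₀ (by positivity)] at hγΘ
    linarith
  have hηγ : 0 < η * γ := mul_pos hη0 hγ0
  have hθ0 : ∀ m, 0 < θ m := fun m => by rw [hθ]; positivity
  have hθ1 : ∀ m, θ m ≤ 1 := fun m => by
    rw [hθ, div_le_one (by positivity)]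
    linarith [Nat.cast_nonneg (α := ℝ) m]
  have hc : ∀ m, hhat m - h m + α m • r m = α m • c m := by
    intro m
    induction m with
    | zero => rw [hhhat0, hh0, hc0, sub_self, zero_add]
    | succ m ih =>
      have hcoef : α (m + 1) * (θ (m + 1) / θ m) = α m := by
        have := (hθ0 m).ne'
        have := (hθ0 (m + 1)).ne'
        rw [hα, hα]
        field_simp
      rw [hcs (m + 1) (Nat.le_add_left 1 m), Nat.add_sub_cancel, smul_add, smul_smul, hcoef,
        smul_sub, ← ih, hhhats, hhs, ← hα]
      abel
  have hstep : ∀ m : ℕ,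
      η * γ * ((m : ℝ) + 2) ^ 2 / 2 * (L (f (m + 1)) - L fstar) + ‖fstar - hhat (m + 1)‖ ^ 2
          + ‖hhat (m + 1) - h (m + 1)‖ ^ 2
        ≤ η * γ * ((m : ℝ) * (m + 2)) / 2 * (L (f m) - L fstar) + ‖fstar - hhat m‖ ^ 2
          + ‖hhat m - h m‖ ^ 2 := by
    intro m
    have key := agbm_potential_step hσ hη0 hη hγ0 hT0 hγT (hθ0 m) (hθ1 m) (hα m)
      (x := fstar) (hg m)
      (separable_smooth_upper hL hsmooth (hr m))
      (fun y => (le_add_of_nonneg_right (by positivity)).trans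
        (separable_strongly_convex_lower hL hstrong (hr m) y))
      (hb1 m) (hc m) (hb2 m)
    rw [← hfs, ← hhhats, hα m, ← hhs] at key
    have e1 : 2 * (η * γ) / θ m ^ 2 = η * γ * ((m : ℝ) + 2) ^ 2 / 2 := by
      rw [hθ]; field_simp
    have e2 : 2 * (η * γ) * ((1 - θ m) / θ m ^ 2) = η * γ * ((m : ℝ) * (m + 2)) / 2 := by
      rw [hθ]; field_simp; ring
    rwa [e1, e2] at key
  have hpot : ∀ m : ℕ,
      η * γ * ((m : ℝ) + 2) ^ 2 / 2 * (L (f (m + 1)) - L fstar) + ‖fstar - hhat (m + 1)‖ ^ 2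
          + ‖hhat (m + 1) - h (m + 1)‖ ^ 2 ≤ ‖w - fstar‖ ^ 2 := by
    intro m
    induction m with
    | zero => simpa [hhhat0, hh0, norm_sub_rev] using hstep 0
    | succ m ih =>
      refine (hstep (m + 1)).trans (le_trans ?_ ih)
      gcongr
      · exact sub_nonneg.2 (hmin _)
      · push_cast
        linarith
  obtain ⟨k, rfl⟩ := Nat.exists_eq_add_of_le' hM
  have hgap : 0 ≤ L (f (k + 1)) - L fstar := sub_nonneg.2 (hmin _)
  have hgrow := quadratic_growth_of_isMin hL hσ hsmooth hstrong hmin w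
  have hrate : η * γ * ((k : ℝ) + 2) ^ 2 / 2 * (L (f (k + 1)) - L fstar) ≤ ‖w - fstar‖ ^ 2 := by
    linarith [hpot k, sq_nonneg ‖fstar - hhat (k + 1)‖, sq_nonneg ‖hhat (k + 1) - h (k + 1)‖]
  have hiter : 8 ≤ ((k : ℝ) + 2) ^ 2 * (η * γ * μ) := by
    rw [div_le_iff₀ (by positivity)] at hMiter
    push_cast at hMiter
    rwa [add_assoc, one_add_one_eq_two] at hMiter
  have h1 := mul_le_mul_of_nonneg_right hiter hgap
  have h2 := mul_le_mul_of_nonneg_left hrate hμ.le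
  rw [hLstar]
  linarith
end

section
/- Under the abstract AGBM iteration, for every m ≥ 0 the auxiliary momentum sequence satisfies ĥ^{m+1} − h^{m+1} = α_m·(cᵐ − b^{m,2}). -/
open scoped RealInnerProductSpace
open Finset

/-- Lemma C.1: under the abstract AGBM iteration, for every `m ≥ 0` the auxiliary
momentum sequence satisfies `ĥ^{m+1} − h^{m+1} = α_m·(cᵐ − b^{m,2})`. -/
theorem agbm_auxiliary_momentum_identity
    (n : ℕ) (hn : 1 ≤ n)
    (σ η γ Θ : ℝ)
    (hσ : 0 < σ) (hη0 : 0 < η) (hη : η ≤ 1 / σ)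
    (hγ0 : 0 < γ) (hγ1 : γ ≤ 1) (hΘ0 : 0 < Θ) (hΘ1 : Θ ≤ 1)
    (w : EuclideanSpace ℝ (Fin n))
    (ℓ ℓ' : Fin n → ℝ → ℝ)
    (hderiv : ∀ i x, HasDerivAt (ℓ i) (ℓ' i x) x)
    (hconv : ∀ i, ConvexOn ℝ Set.univ (ℓ i))
    (hsmooth : ∀ i a b, ℓ i a ≤ ℓ i b + ℓ' i b * (a - b) + σ / 2 * (a - b) ^ 2)
    (L : EuclideanSpace ℝ (Fin n) → ℝ)
    (hL : ∀ v, L v = ∑ i, ℓ i (v i))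
    (θ α : ℕ → ℝ)
    (hθ : ∀ m : ℕ, θ m = 2 / (m + 2))
    (hα : ∀ m : ℕ, α m = η * γ / θ m)
    (f h hhat g r b1 c b2 : ℕ → EuclideanSpace ℝ (Fin n))
    (hf0 : f 0 = w) (hh0 : h 0 = w) (hhhat0 : hhat 0 = w)
    (hg : ∀ m, g m = (1 - θ m) • f m + θ m • h m)
    (hr : ∀ m i, r m i = -(ℓ' i (g m i)))
    (hb1 : ∀ m, ‖b1 m - r m‖ ^ 2 ≤ (1 - Θ ^ 2) * ‖r m‖ ^ 2)
    (hfs : ∀ m, f (m + 1) = g m + η • b1 m)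
    (hc0 : c 0 = r 0)
    (hcs : ∀ m, 1 ≤ m → c m = r m + (θ m / θ (m - 1)) • (c (m - 1) - b2 (m - 1)))
    (hb2 : ∀ m, ‖b2 m - c m‖ ^ 2 ≤ (1 - Θ ^ 2) * ‖c m‖ ^ 2)
    (hhs : ∀ m, h (m + 1) = h m + (η * γ / θ m) • b2 m)
    (hhhats : ∀ m, hhat (m + 1) = hhat m + α m • r m)
    (m : ℕ) :
    hhat (m + 1) - h (m + 1) = α m • (c m - b2 m) := by
  have hθ_ne (k : ℕ) : θ k ≠ 0 := by
    rw [hθ]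
    positivity
  induction m with
  | zero =>
    rw [hhhats, hhs, hhhat0, hh0, hc0, ← hα, smul_sub]
    abel
  | succ k ih =>
    have hα_mul : α (k + 1) * (θ (k + 1) / θ k) = α k := by
      rw [hα, hα]
      field_simp [hθ_ne k, hθ_ne (k + 1)]
    calc
      hhat (k + 1 + 1) - h (k + 1 + 1)
          = (hhat (k + 1) - h (k + 1)) + α (k + 1) • (r (k + 1) - b2 (k + 1)) := by
        rw [hhhats (k + 1), hhs (k + 1), ← hα, smul_sub]
        abel
      _ = α (k + 1) • (c (k + 1) - b2 (k + 1)) := by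
        rw [ih, hcs (k + 1) (Nat.le_add_left 1 k), Nat.add_sub_cancel, ← hα_mul, mul_smul,
          ← smul_add]
        congr 1
        abel
end

section
/- Under the abstract AGBM iteration, the loss decreases sufficiently at every step: for all m ≥ 0, L(f^{m+1}) ≤ L(gᵐ) − (ηΘ²/2)·‖rᵐ‖². -/
open scoped RealInnerProductSpace
open Finset

/-- Descent estimate for an inexact gradient step on a separable smooth function. -/
theorem sum_add_smul_le_of_smooth {ι : Type*} [Fintype ι] {σ η : ℝ} (hη0 : 0 ≤ η)
    (hση : η * σ ≤ 1) (ℓ ℓ' : ι → ℝ → ℝ)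
    (hsmooth : ∀ i a b, ℓ i a ≤ ℓ i b + ℓ' i b * (a - b) + σ / 2 * (a - b) ^ 2)
    (g b r : EuclideanSpace ℝ ι) (hr : ∀ i, r i = -(ℓ' i (g i))) :
    ∑ i, ℓ i ((g + η • b) i) ≤ ∑ i, ℓ i (g i) + η / 2 * (‖b - r‖ ^ 2 - ‖r‖ ^ 2) := by
  rw [EuclideanSpace.real_norm_sq_eq, EuclideanSpace.real_norm_sq_eq, ← sum_sub_distrib,
    mul_sum, ← sum_add_distrib]
  refine sum_le_sum fun i _ => ?_
  have h := hsmooth i (g i + η * b i) (g i)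
  have hle : 0 ≤ (1 - η * σ) * (η * b i ^ 2) :=
    mul_nonneg (sub_nonneg.2 hση) (mul_nonneg hη0 (sq_nonneg _))
  simp only [PiLp.add_apply, PiLp.smul_apply, PiLp.sub_apply, smul_eq_mul, hr]
  linarith

/-- Lemma C.2 (sufficient decrease): under the abstract AGBM iteration, for all `m ≥ 0`,
`L(f^{m+1}) ≤ L(gᵐ) − (ηΘ²/2)·‖rᵐ‖²`. -/
theorem agbm_sufficient_decrease
    (n : ℕ) (hn : 1 ≤ n)
    (σ η γ Θ : ℝ)
    (hσ : 0 < σ) (hη0 : 0 < η) (hη : η ≤ 1 / σ)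
    (hγ0 : 0 < γ) (hγ1 : γ ≤ 1) (hΘ0 : 0 < Θ) (hΘ1 : Θ ≤ 1)
    (w : EuclideanSpace ℝ (Fin n))
    (ℓ ℓ' : Fin n → ℝ → ℝ)
    (hderiv : ∀ i x, HasDerivAt (ℓ i) (ℓ' i x) x)
    (hconv : ∀ i, ConvexOn ℝ Set.univ (ℓ i))
    (hsmooth : ∀ i a b, ℓ i a ≤ ℓ i b + ℓ' i b * (a - b) + σ / 2 * (a - b) ^ 2)
    (L : EuclideanSpace ℝ (Fin n) → ℝ)
    (hL : ∀ v, L v = ∑ i, ℓ i (v i))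
    (θ : ℕ → ℝ)
    (hθ : ∀ m : ℕ, θ m = 2 / (m + 2))
    (f h g r b1 b2 : ℕ → EuclideanSpace ℝ (Fin n))
    (hf0 : f 0 = w) (hh0 : h 0 = w)
    (hg : ∀ m, g m = (1 - θ m) • f m + θ m • h m)
    (hr : ∀ m i, r m i = -(ℓ' i (g m i)))
    (hb1 : ∀ m, ‖b1 m - r m‖ ^ 2 ≤ (1 - Θ ^ 2) * ‖r m‖ ^ 2)
    (hfs : ∀ m, f (m + 1) = g m + η • b1 m)
    (hhs : ∀ m, h (m + 1) = h m + (η * γ / θ m) • b2 m)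
    (m : ℕ) :
    L (f (m + 1)) ≤ L (g m) - η * Θ ^ 2 / 2 * ‖r m‖ ^ 2 := by
  have hstep := sum_add_smul_le_of_smooth hη0.le ((le_div_iff₀ hσ).1 hη) ℓ ℓ' hsmooth
    (g m) (b1 m) (r m) (hr m)
  have hmul := mul_le_mul_of_nonneg_left (hb1 m) (half_pos hη0).le
  rw [hL, hL, hfs]
  linarith
end

section
/- Under the abstract AGBM iteration with γ ≤ Θ⁴/(4+Θ²), set s = γ/Θ² and t = (1−s)/2, and define the potentials V⁰ = (1/2)‖f★ − ĥ⁰‖² and, for m ≥ 1, Vᵐ = (α_{m−1}/θ_{m−1})·(L(fᵐ) − L★) + (1/2)‖f★ − ĥᵐ‖², and the error terms δ_m = (s·α_{m−1}²/(2t))·‖c^{m−1} − b^{m−1,2}‖² − (1−s−t)·(α_m²/(2s))·‖rᵐ‖² (with the conventions α_{−1} = 0 and c^{−1} = b^{−1,2} = 0). Then for every m ≥ 0: V^{m+1} ≤ Vᵐ + δ_m. -/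
open scoped RealInnerProductSpace
open Finset

/-- The tangent line of a differentiable convex function on `ℝ` lies below its graph. -/
theorem ConvexOn.add_deriv_mul_sub_le {φ : ℝ → ℝ} {φ' x : ℝ}
    (hφ : ConvexOn ℝ Set.univ φ) (hd : HasDerivAt φ φ' x) (y : ℝ) :
    φ x + φ' * (y - x) ≤ φ y := by
  rcases lt_trichotomy x y with hxy | rfl | hxy
  · have := hφ.le_slope_of_hasDerivAt (Set.mem_univ x) (Set.mem_univ y) hxy hd
    rw [slope_def_field, le_div_iff₀ (sub_pos.2 hxy)] at this
    linarith
  · simp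
  · have := hφ.slope_le_of_hasDerivAt (Set.mem_univ y) (Set.mem_univ x) hxy hd
    rw [slope_def_field, div_le_iff₀ (sub_pos.2 hxy)] at this
    linarith

section Separable

variable {ι : Type*} [Fintype ι] {ℓ ℓ' : ι → ℝ → ℝ} {a b r : EuclideanSpace ℝ ι}

/-- The gradient inequality for a separable convex function, `r` being the negative gradient
at `b`. -/
theorem separable_sub_inner_le (hderiv : ∀ i x, HasDerivAt (ℓ i) (ℓ' i x) x)
    (hconv : ∀ i, ConvexOn ℝ Set.univ (ℓ i)) (hr : ∀ i, r i = -ℓ' i (b i)) :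
    ∑ i, ℓ i (b i) - ⟪r, a - b⟫ ≤ ∑ i, ℓ i (a i) := by
  rw [PiLp.inner_apply, ← Finset.sum_sub_distrib]
  refine Finset.sum_le_sum fun i _ => ?_
  have := (hconv i).add_deriv_mul_sub_le (hderiv i (b i)) (a i)
  simp only [PiLp.sub_apply, hr, RCLike.inner_apply, conj_trivial]
  linarith

/-- The quadratic upper bound for a separable smooth function, `r` being the negative gradient
at `b`. -/
theorem separable_le_sub_inner_add {σ : ℝ}
    (hsmooth : ∀ i a b, ℓ i a ≤ ℓ i b + ℓ' i b * (a - b) + σ / 2 * (a - b) ^ 2)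
    (hr : ∀ i, r i = -ℓ' i (b i)) :
    ∑ i, ℓ i (a i) ≤ ∑ i, ℓ i (b i) - ⟪r, a - b⟫ + σ / 2 * ‖a - b‖ ^ 2 := by
  rw [PiLp.inner_apply, EuclideanSpace.real_norm_sq_eq, Finset.mul_sum,
    ← Finset.sum_sub_distrib, ← Finset.sum_add_distrib]
  refine Finset.sum_le_sum fun i _ => ?_
  have := hsmooth i (a i) (b i)
  simp only [PiLp.sub_apply, hr, RCLike.inner_apply, conj_trivial]
  linarith

end Separable

section InnerProductSpace

variable {E : Type*} [NormedAddCommGroup E] [InnerProductSpace ℝ E]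

/-- Sufficient decrease of a smooth function along an inexact negative gradient step `η • b`. -/
theorem inexact_gradient_step_le {L : E → ℝ} {σ η Θ : ℝ} {g r b : E} (hη0 : 0 < η)
    (hσ : 0 < σ) (hη : η ≤ 1 / σ)
    (hsmooth : ∀ a, L a ≤ L g - ⟪r, a - g⟫ + σ / 2 * ‖a - g‖ ^ 2)
    (hb : ‖b - r‖ ^ 2 ≤ (1 - Θ ^ 2) * ‖r‖ ^ 2) :
    L (g + η • b) ≤ L g - η * Θ ^ 2 / 2 * ‖r‖ ^ 2 := by
  have h1 := hsmooth (g + η • b)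
  rw [add_sub_cancel_left, inner_smul_right, norm_smul, mul_pow, Real.norm_eq_abs, sq_abs] at h1
  rw [norm_sub_sq_real, real_inner_comm] at hb
  rw [le_div_iff₀ hσ] at hη
  have h2 : η * ((η * σ) * ‖b‖ ^ 2) ≤ η * (1 * ‖b‖ ^ 2) := by gcongr
  have h3 := mul_le_mul_of_nonneg_left hb hη0.le
  nlinarith

/-- Young's inequality with weights `t` and `s`. -/
theorem real_inner_le_weighted {s t : ℝ} (hs : 0 < s) (ht : 0 < t) (x y : E) :
    ⟪x, y⟫ ≤ t / (2 * s) * ‖x‖ ^ 2 + s / (2 * t) * ‖y‖ ^ 2 := by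
  have h := sq_nonneg (t * ‖x‖ - s * ‖y‖)
  have : t / (2 * s) * ‖x‖ ^ 2 + s / (2 * t) * ‖y‖ ^ 2 - ‖x‖ * ‖y‖
      = (t * ‖x‖ - s * ‖y‖) ^ 2 / (2 * s * t) := by
    field_simp
    ring
  have : 0 ≤ (t * ‖x‖ - s * ‖y‖) ^ 2 / (2 * s * t) := by positivity
  linarith [real_inner_le_norm x y]

/-- One accelerated step: the potential decreases up to the correlation of the gradient with
the gap `hhat - h` between the exact and the inexact momentum sequences. -/
theorem accelerated_step_le {L : E → ℝ} {θ α κ Lf' : ℝ} {f g h hhat r x : E}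
    (hθ : 0 < θ) (hθ1 : θ ≤ 1) (hα : 0 ≤ α) (hg : g = (1 - θ) • f + θ • h)
    (hconv : ∀ a, L g - ⟪r, a - g⟫ ≤ L a) (hLf' : Lf' ≤ L g - κ * ‖r‖ ^ 2) :
    α / θ * (Lf' - L x) + 1 / 2 * ‖x - (hhat + α • r)‖ ^ 2
      ≤ α / θ * (1 - θ) * (L f - L x) + 1 / 2 * ‖x - hhat‖ ^ 2
        + ⟪α • r, hhat - h⟫ + (α ^ 2 / 2 - α / θ * κ) * ‖r‖ ^ 2 := by
  have hβ : 0 ≤ α / θ := by positivity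
  have hαθ : α = α / θ * θ := by field_simp
  have e1 : ‖x - (hhat + α • r)‖ ^ 2
      = ‖x - hhat‖ ^ 2 - 2 * (α * ⟪r, x - hhat⟫) + α ^ 2 * ‖r‖ ^ 2 := by
    rw [← sub_sub, norm_sub_sq_real, inner_smul_right, norm_smul, mul_pow, Real.norm_eq_abs,
      sq_abs, real_inner_comm]
  have e2 : θ * ⟪r, x - h⟫ = θ * ⟪r, x - g⟫ + (1 - θ) * ⟪r, f - g⟫ := by
    simp only [← inner_smul_right, ← inner_add_right]
    congr 1
    rw [hg]
    module
  have e3 : ⟪r, x - hhat⟫ = ⟪r, x - h⟫ - ⟪r, hhat - h⟫ := by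
    rw [← inner_sub_right, sub_sub_sub_cancel_right]
  have h1 : θ * (L g - L x) + (1 - θ) * (L g - L f) ≤ θ * ⟪r, x - h⟫ := by
    rw [e2]
    exact add_le_add (mul_le_mul_of_nonneg_left (by linarith [hconv x]) hθ.le)
      (mul_le_mul_of_nonneg_left (by linarith [hconv f]) (sub_nonneg.2 hθ1))
  have h2 := mul_le_mul_of_nonneg_left h1 hβ
  have h3 := mul_le_mul_of_nonneg_left hLf' hβ
  have h4 : α / θ * (θ * ⟪r, x - h⟫) = α * ⟪r, x - h⟫ := by rw [← mul_assoc, ← hαθ]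
  rw [e1, e3, real_inner_smul_left]
  linarith

/-- The accumulated residual measures the gap between exact and inexact momentum sequences. -/
theorem momentum_gap_eq {κ : ℝ} {θ : ℕ → ℝ} {h hhat r c b : ℕ → E} (hθ : ∀ m, θ m ≠ 0)
    (h0 : hhat 0 = h 0) (hc0 : c 0 = r 0)
    (hcs : ∀ m, c (m + 1) = r (m + 1) + (θ (m + 1) / θ m) • (c m - b m))
    (hhs : ∀ m, h (m + 1) = h m + (κ / θ m) • b m)
    (hhhats : ∀ m, hhat (m + 1) = hhat m + (κ / θ m) • r m) (m : ℕ) :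
    hhat (m + 1) - h (m + 1) = (κ / θ m) • (c m - b m) := by
  induction m with
  | zero =>
    rw [hhs, hhhats, h0, hc0]
    module
  | succ m ih =>
    have key : κ / θ (m + 1) * (θ (m + 1) / θ m) = κ / θ m := by
      have := hθ m
      have := hθ (m + 1)
      field_simp
    rw [hhs, hhhats, add_sub_add_comm, ih, ← key, hcs m]
    module

end InnerProductSpace

/-- Lemma C.4 (potential decrease): with `γ ≤ Θ⁴/(4+Θ²)`, `s = γ/Θ²`, `t = (1−s)/2`,
potentials `V⁰ = (1/2)‖f★ − ĥ⁰‖²`, `Vᵐ = (α_{m−1}/θ_{m−1})(L(fᵐ) − L★) + (1/2)‖f★ − ĥᵐ‖²`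
for `m ≥ 1`, and errors `δ_m`, one has `V^{m+1} ≤ Vᵐ + δ_m` for every `m ≥ 0`. -/
theorem agbm_potential_decrease
    (n : ℕ) (hn : 1 ≤ n)
    (σ η γ Θ : ℝ)
    (hσ : 0 < σ) (hη0 : 0 < η) (hη : η ≤ 1 / σ)
    (hγ0 : 0 < γ) (hγ1 : γ ≤ 1) (hΘ0 : 0 < Θ) (hΘ1 : Θ ≤ 1)
    (w : EuclideanSpace ℝ (Fin n))
    (ℓ ℓ' : Fin n → ℝ → ℝ)
    (hderiv : ∀ i x, HasDerivAt (ℓ i) (ℓ' i x) x)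
    (hconv : ∀ i, ConvexOn ℝ Set.univ (ℓ i))
    (hsmooth : ∀ i a b, ℓ i a ≤ ℓ i b + ℓ' i b * (a - b) + σ / 2 * (a - b) ^ 2)
    (L : EuclideanSpace ℝ (Fin n) → ℝ)
    (hL : ∀ v, L v = ∑ i, ℓ i (v i))
    (θ α : ℕ → ℝ)
    (hθ : ∀ m : ℕ, θ m = 2 / (m + 2))
    (hα : ∀ m : ℕ, α m = η * γ / θ m)
    (f h hhat g r b1 c b2 : ℕ → EuclideanSpace ℝ (Fin n))
    (hf0 : f 0 = w) (hh0 : h 0 = w) (hhhat0 : hhat 0 = w)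
    (hg : ∀ m, g m = (1 - θ m) • f m + θ m • h m)
    (hr : ∀ m i, r m i = -(ℓ' i (g m i)))
    (hb1 : ∀ m, ‖b1 m - r m‖ ^ 2 ≤ (1 - Θ ^ 2) * ‖r m‖ ^ 2)
    (hfs : ∀ m, f (m + 1) = g m + η • b1 m)
    (hc0 : c 0 = r 0)
    (hcs : ∀ m, 1 ≤ m → c m = r m + (θ m / θ (m - 1)) • (c (m - 1) - b2 (m - 1)))
    (hb2 : ∀ m, ‖b2 m - c m‖ ^ 2 ≤ (1 - Θ ^ 2) * ‖c m‖ ^ 2)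
    (hhs : ∀ m, h (m + 1) = h m + (η * γ / θ m) • b2 m)
    (hhhats : ∀ m, hhat (m + 1) = hhat m + α m • r m)
    (hγΘ : γ ≤ Θ ^ 4 / (4 + Θ ^ 2))
    (fstar : EuclideanSpace ℝ (Fin n)) (Lstar : ℝ)
    (hmin : ∀ v, L fstar ≤ L v) (hLstar : Lstar = L fstar)
    (s t : ℝ) (hs : s = γ / Θ ^ 2) (ht : t = (1 - s) / 2)
    (δ : ℕ → ℝ)
    (hδ0 : δ 0 = -((1 - s - t) * (α 0 ^ 2 / (2 * s)) * ‖r 0‖ ^ 2))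
    (hδ : ∀ m, 1 ≤ m → δ m = s * α (m - 1) ^ 2 / (2 * t) * ‖c (m - 1) - b2 (m - 1)‖ ^ 2
      - (1 - s - t) * (α m ^ 2 / (2 * s)) * ‖r m‖ ^ 2)
    (V : ℕ → ℝ)
    (hV0 : V 0 = 1 / 2 * ‖fstar - hhat 0‖ ^ 2)
    (hV : ∀ m, 1 ≤ m → V m = α (m - 1) / θ (m - 1) * (L (f m) - Lstar)
      + 1 / 2 * ‖fstar - hhat m‖ ^ 2)
    (m : ℕ) :
    V (m + 1) ≤ V m + δ m := by
  have hθpos : ∀ k, 0 < θ k := fun k => by rw [hθ]; positivity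
  have hθ1 : θ m ≤ 1 := by
    rw [hθ, div_le_one (by positivity)]
    linarith [(Nat.cast_nonneg m : (0 : ℝ) ≤ m)]
  have hαpos : ∀ k, 0 < α k := fun k => by
    have := hθpos k
    rw [hα]
    positivity
  have hs0 : 0 < s := by rw [hs]; positivity
  have hs1 : s < 1 := by
    rw [hs, div_lt_one (by positivity)]
    refine hγΘ.trans_lt ?_
    rw [div_lt_iff₀ (by positivity)]
    nlinarith [pow_pos hΘ0 2]
  have ht0 : 0 < t := by rw [ht]; linarith
  have hdesc : L (f (m + 1)) ≤ L (g m) - η * Θ ^ 2 / 2 * ‖r m‖ ^ 2 := by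
    rw [hfs]
    refine inexact_gradient_step_le hη0 hσ hη (fun a => ?_) (hb1 m)
    rw [hL, hL]
    exact separable_le_sub_inner_add hsmooth (hr m)
  have hstep := accelerated_step_le (x := fstar) (hhat := hhat m) (hθpos m) hθ1 (hαpos m).le
    (hg m) (fun a => by
      rw [hL, hL]
      exact separable_sub_inner_le hderiv hconv (hr m)) hdesc
  have hcoef : α m / θ m * (η * Θ ^ 2 / 2) = α m ^ 2 / (2 * s) := by
    have := (hθpos m).ne'
    rw [hα, hs]
    field_simp
  have hcoef' : α m ^ 2 / 2 - α m ^ 2 / (2 * s) = -((1 - s) * (α m ^ 2 / (2 * s))) := by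
    field_simp
    ring
  rw [hcoef, hcoef', ← hhhats] at hstep
  rw [hV (m + 1) (by omega), Nat.add_sub_cancel, hLstar]
  refine hstep.trans ?_
  cases m with
  | zero =>
    have hθ0 : θ 0 = 1 := by rw [hθ]; norm_num
    have : 0 ≤ t * (α 0 ^ 2 / (2 * s)) * ‖r 0‖ ^ 2 := by positivity
    rw [hV0, hδ0, hθ0, hhhat0, hh0, sub_self, sub_self, inner_zero_right]
    linarith
  | succ k =>
    have hgap : hhat (k + 1) - h (k + 1) = α k • (c k - b2 k) := by
      rw [hα]
      exact momentum_gap_eq (fun k => (hθpos k).ne') (hhhat0.trans hh0.symm) hc0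
        (fun k => hcs (k + 1) (by omega)) hhs (fun k => by rw [hhhats, hα]) k
    have hyoung := real_inner_le_weighted hs0 ht0 (α (k + 1) • r (k + 1)) (α k • (c k - b2 k))
    rw [norm_smul, norm_smul, mul_pow, mul_pow, Real.norm_eq_abs, Real.norm_eq_abs,
      sq_abs, sq_abs] at hyoung
    have hweight : α (k + 1) / θ (k + 1) * (1 - θ (k + 1)) ≤ α k / θ k := by
      have e1 : α (k + 1) / θ (k + 1) * (1 - θ (k + 1))
          = η * γ * (((k : ℝ) + 1) * (k + 3) / 4) := by
        rw [hα, hθ]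
        push_cast
        field_simp
        ring
      have e2 : α k / θ k = η * γ * (((k : ℝ) + 2) ^ 2 / 4) := by
        rw [hα, hθ]
        field_simp
        ring
      rw [e1, e2]
      gcongr
      nlinarith
    have hvalue := mul_le_mul_of_nonneg_right hweight (sub_nonneg.2 (hmin (f (k + 1))))
    rw [hV (k + 1) (by omega), hδ (k + 1) (by omega), Nat.add_sub_cancel, hLstar, hgap]
    have e3 : s / (2 * t) * (α k ^ 2 * ‖c k - b2 k‖ ^ 2)
        = s * α k ^ 2 / (2 * t) * ‖c k - b2 k‖ ^ 2 := by ring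
    have e4 : t / (2 * s) * (α (k + 1) ^ 2 * ‖r (k + 1)‖ ^ 2)
        = t * (α (k + 1) ^ 2 / (2 * s)) * ‖r (k + 1)‖ ^ 2 := by ring
    linarith
end

section
/- Under the abstract AGBM iteration with γ ≤ Θ⁴/(4+Θ²), set s = γ/Θ² and t = (1−s)/2 and define δ_m = (s·α_{m−1}²/(2t))·‖c^{m−1} − b^{m−1,2}‖² − (1−s−t)·(α_m²/(2s))·‖rᵐ‖² (with conventions α_{−1} = 0 and c^{−1} = b^{−1,2} = 0). Then for every m ≥ 0 the accumulated error is nonpositive: ∑_{j=0}^{m} δ_j ≤ 0; equivalently, ∑_{j=0}^{m−1} α_j²‖c^j − b^{j,2}‖² ≤ (t(1−s−t)/s²)·∑_{j=0}^{m} α_j²‖r^j‖². -/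
open scoped RealInnerProductSpace
open Finset

/-- A weighted Young inequality for a contraction factor `1 - q`. -/
lemma one_sub_mul_norm_add_sq_le {E : Type*} [SeminormedAddCommGroup E] {q : ℝ} (hq0 : 0 < q)
    (hq1 : q ≤ 1) (x y : E) :
    (1 - q) * ‖x + y‖ ^ 2 ≤ (1 - q / 2) * ‖y‖ ^ 2 + 2 / q * ‖x‖ ^ 2 := by
  have hsq : ‖x + y‖ ^ 2 ≤ (‖x‖ + ‖y‖) ^ 2 := by gcongr; exact norm_add_le x y
  refine (mul_le_mul_of_nonneg_left hsq (sub_nonneg.2 hq1)).trans ?_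
  have hid : (1 - q / 2) * ‖y‖ ^ 2 + 2 / q * ‖x‖ ^ 2 - (1 - q) * (‖x‖ + ‖y‖) ^ 2
      = ((q * ‖y‖ - 2 * (1 - q) * ‖x‖) ^ 2 + 2 * q * (3 - q) * ‖x‖ ^ 2) / (2 * q) := by
    field_simp
    ring
  have hnn : 0 ≤ ((q * ‖y‖ - 2 * (1 - q) * ‖x‖) ^ 2 + 2 * q * (3 - q) * ‖x‖ ^ 2) / (2 * q) := by
    have : 0 ≤ 3 - q := by linarith
    positivity
  linarith

/-- Summing the linear recursion `e (m + 1) ≤ (1 - q / 2) * e m + (2 / q) * ρ (m + 1)`. -/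
lemma sum_le_of_contracting_recursion {q : ℝ} (hq0 : 0 < q) (hq1 : q ≤ 1) {e ρ : ℕ → ℝ}
    (he : ∀ m, 0 ≤ e m) (h0 : e 0 ≤ 2 / q * ρ 0)
    (hstep : ∀ m, e (m + 1) ≤ (1 - q / 2) * e m + 2 / q * ρ (m + 1)) (m : ℕ) :
    ∑ j ∈ Finset.range (m + 1), e j ≤ 4 / q ^ 2 * ∑ j ∈ Finset.range (m + 1), ρ j := by
  have hscale {x a b : ℝ} (h : x ≤ (1 - q / 2) * a + 2 / q * b) :
      2 / q * x ≤ (2 / q - 1) * a + 4 / q ^ 2 * b := by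
    calc 2 / q * x ≤ 2 / q * ((1 - q / 2) * a + 2 / q * b) := by gcongr
      _ = (2 / q - 1) * a + 4 / q ^ 2 * b := by field_simp; ring
  have hinv : ∑ j ∈ Finset.range (m + 1), e j + (2 / q - 1) * e m
      ≤ 4 / q ^ 2 * ∑ j ∈ Finset.range (m + 1), ρ j := by
    induction m with
    | zero =>
      have := hscale (x := e 0) (a := 0) (b := ρ 0) (by linarith)
      simp only [zero_add, Finset.sum_range_one]
      linarith
    | succ m ih =>
      have := hscale (hstep m)
      rw [Finset.sum_range_succ e, Finset.sum_range_succ ρ]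
      linarith
  have hq : 0 ≤ 2 / q - 1 := by
    rw [sub_nonneg, le_div_iff₀ hq0]
    linarith
  linarith [mul_nonneg hq (he m)]

/-- Lemma C.5 (accumulated error is nonpositive): with `γ ≤ Θ⁴/(4+Θ²)`, `s = γ/Θ²`,
`t = (1−s)/2`, for every `m ≥ 0`: `∑_{j=0}^m δ_j ≤ 0`; equivalently,
`∑_{j=0}^{m−1} α_j²‖c^j − b^{j,2}‖² ≤ (t(1−s−t)/s²)·∑_{j=0}^m α_j²‖r^j‖²`. -/
theorem agbm_accumulated_error_nonpositive
    (n : ℕ) (hn : 1 ≤ n)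
    (σ η γ Θ : ℝ)
    (hσ : 0 < σ) (hη0 : 0 < η) (hη : η ≤ 1 / σ)
    (hγ0 : 0 < γ) (hγ1 : γ ≤ 1) (hΘ0 : 0 < Θ) (hΘ1 : Θ ≤ 1)
    (w : EuclideanSpace ℝ (Fin n))
    (ℓ ℓ' : Fin n → ℝ → ℝ)
    (hderiv : ∀ i x, HasDerivAt (ℓ i) (ℓ' i x) x)
    (hconv : ∀ i, ConvexOn ℝ Set.univ (ℓ i))
    (hsmooth : ∀ i a b, ℓ i a ≤ ℓ i b + ℓ' i b * (a - b) + σ / 2 * (a - b) ^ 2)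
    (L : EuclideanSpace ℝ (Fin n) → ℝ)
    (hL : ∀ v, L v = ∑ i, ℓ i (v i))
    (θ α : ℕ → ℝ)
    (hθ : ∀ m : ℕ, θ m = 2 / (m + 2))
    (hα : ∀ m : ℕ, α m = η * γ / θ m)
    (f h hhat g r b1 c b2 : ℕ → EuclideanSpace ℝ (Fin n))
    (hf0 : f 0 = w) (hh0 : h 0 = w) (hhhat0 : hhat 0 = w)
    (hg : ∀ m, g m = (1 - θ m) • f m + θ m • h m)
    (hr : ∀ m i, r m i = -(ℓ' i (g m i)))
    (hb1 : ∀ m, ‖b1 m - r m‖ ^ 2 ≤ (1 - Θ ^ 2) * ‖r m‖ ^ 2)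
    (hfs : ∀ m, f (m + 1) = g m + η • b1 m)
    (hc0 : c 0 = r 0)
    (hcs : ∀ m, 1 ≤ m → c m = r m + (θ m / θ (m - 1)) • (c (m - 1) - b2 (m - 1)))
    (hb2 : ∀ m, ‖b2 m - c m‖ ^ 2 ≤ (1 - Θ ^ 2) * ‖c m‖ ^ 2)
    (hhs : ∀ m, h (m + 1) = h m + (η * γ / θ m) • b2 m)
    (hhhats : ∀ m, hhat (m + 1) = hhat m + α m • r m)
    (hγΘ : γ ≤ Θ ^ 4 / (4 + Θ ^ 2))
    (s t : ℝ) (hs : s = γ / Θ ^ 2) (ht : t = (1 - s) / 2)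
    (δ : ℕ → ℝ)
    (hδ0 : δ 0 = -((1 - s - t) * (α 0 ^ 2 / (2 * s)) * ‖r 0‖ ^ 2))
    (hδ : ∀ m, 1 ≤ m → δ m = s * α (m - 1) ^ 2 / (2 * t) * ‖c (m - 1) - b2 (m - 1)‖ ^ 2
      - (1 - s - t) * (α m ^ 2 / (2 * s)) * ‖r m‖ ^ 2)
    (m : ℕ) :
    (∑ j ∈ Finset.range (m + 1), δ j ≤ 0) ∧
      (∑ j ∈ Finset.range m, α j ^ 2 * ‖c j - b2 j‖ ^ 2
        ≤ t * (1 - s - t) / s ^ 2 * ∑ j ∈ Finset.range (m + 1), α j ^ 2 * ‖r j‖ ^ 2) := by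
  have hq0 : 0 < Θ ^ 2 := by positivity
  have hq1 : Θ ^ 2 ≤ 1 := pow_le_one₀ hΘ0.le hΘ1
  have hs0 : 0 < s := by rw [hs]; positivity
  have hsq : s * (4 + Θ ^ 2) ≤ Θ ^ 2 := by
    rw [le_div_iff₀ (by positivity)] at hγΘ
    rw [hs, div_mul_eq_mul_div, div_le_iff₀ hq0]
    linarith
  have ht0 : 0 < t := by nlinarith
  have hst : 1 - s - t = t := by linarith
  have hratio : 4 / (Θ ^ 2) ^ 2 ≤ t * t / s ^ 2 := by
    have : 2 / Θ ^ 2 ≤ t / s := by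
      rw [div_le_div_iff₀ hq0 hs0]
      nlinarith
    calc 4 / (Θ ^ 2) ^ 2 = (2 / Θ ^ 2) ^ 2 := by ring
      _ ≤ (t / s) ^ 2 := by gcongr
      _ = t * t / s ^ 2 := by ring
  have herr (k : ℕ) : ‖c k - b2 k‖ ^ 2 ≤ (1 - Θ ^ 2) * ‖c k‖ ^ 2 := by
    rw [norm_sub_rev]
    exact hb2 k
  have hθ0 (k : ℕ) : 0 < θ k := by rw [hθ]; positivity
  have hnorm (k : ℕ) (x : EuclideanSpace ℝ (Fin n)) : ‖α k • x‖ ^ 2 = α k ^ 2 * ‖x‖ ^ 2 := by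
    rw [norm_smul, mul_pow, Real.norm_eq_abs, sq_abs]
  have hscaled (k : ℕ) : α k ^ 2 * ‖c k - b2 k‖ ^ 2 ≤ (1 - Θ ^ 2) * ‖α k • c k‖ ^ 2 := by
    rw [hnorm]
    linarith [mul_le_mul_of_nonneg_left (herr k) (sq_nonneg (α k))]
  have hrec (k : ℕ) : α (k + 1) • c (k + 1) = α (k + 1) • r (k + 1) + α k • (c k - b2 k) := by
    rw [hcs (k + 1) (by omega), Nat.add_sub_cancel, smul_add, smul_smul]
    congr 2
    have := (hθ0 k).ne'
    have := (hθ0 (k + 1)).ne'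
    rw [hα, hα]
    field_simp
  have hsum (k : ℕ) : ∑ j ∈ Finset.range (k + 1), α j ^ 2 * ‖c j - b2 j‖ ^ 2
      ≤ 4 / (Θ ^ 2) ^ 2 * ∑ j ∈ Finset.range (k + 1), α j ^ 2 * ‖r j‖ ^ 2 := by
    refine sum_le_of_contracting_recursion hq0 hq1 (e := fun j ↦ α j ^ 2 * ‖c j - b2 j‖ ^ 2)
      (ρ := fun j ↦ α j ^ 2 * ‖r j‖ ^ 2) (fun j ↦ by positivity) ?_ (fun j ↦ ?_) k
    · refine (hscaled 0).trans ?_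
      simpa [hc0, hnorm] using one_sub_mul_norm_add_sq_le hq0 hq1 (α 0 • r 0) 0
    · refine (hscaled (j + 1)).trans ?_
      simpa only [hrec, hnorm] using
        one_sub_mul_norm_add_sq_le hq0 hq1 (α (j + 1) • r (j + 1)) (α j • (c j - b2 j))
  have hmain : ∑ j ∈ Finset.range m, α j ^ 2 * ‖c j - b2 j‖ ^ 2
      ≤ t * t / s ^ 2 * ∑ j ∈ Finset.range (m + 1), α j ^ 2 * ‖r j‖ ^ 2 := by
    calc ∑ j ∈ Finset.range m, α j ^ 2 * ‖c j - b2 j‖ ^ 2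
        ≤ ∑ j ∈ Finset.range (m + 1), α j ^ 2 * ‖c j - b2 j‖ ^ 2 := by
          rw [Finset.sum_range_succ]
          exact le_add_of_nonneg_right (by positivity)
      _ ≤ 4 / (Θ ^ 2) ^ 2 * ∑ j ∈ Finset.range (m + 1), α j ^ 2 * ‖r j‖ ^ 2 := hsum m
      _ ≤ _ := by gcongr
  rw [hst]
  refine ⟨?_, hmain⟩
  have hδsum : ∑ j ∈ Finset.range (m + 1), δ j
      = s / (2 * t) * (∑ j ∈ Finset.range m, α j ^ 2 * ‖c j - b2 j‖ ^ 2
        - t * t / s ^ 2 * ∑ j ∈ Finset.range (m + 1), α j ^ 2 * ‖r j‖ ^ 2) := by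
    clear hmain
    induction m with
    | zero =>
      simp only [zero_add, Finset.sum_range_one, Finset.sum_range_zero, hδ0, hst]
      field_simp
      ring
    | succ m ih =>
      rw [Finset.sum_range_succ δ, ih, hδ (m + 1) (by omega), hst, Nat.add_sub_cancel,
        Finset.sum_range_succ (fun j ↦ α j ^ 2 * ‖c j - b2 j‖ ^ 2) m,
        Finset.sum_range_succ (fun j ↦ α j ^ 2 * ‖r j‖ ^ 2) (m + 1)]
      field_simp
      ring
  rw [hδsum]
  exact mul_nonpos_of_nonneg_of_nonpos (by positivity) (sub_nonpos.2 hmain)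
end

section
/- Under the abstract AGBM iteration, the error of the corrected residual satisfies the recursive bound: for every m ≥ 0 and every ρ > 0, ‖c^{m+1} − b^{m+1,2}‖² ≤ (1+ρ)(1−Θ²)‖r^{m+1}‖² + (1+1/ρ)(1−Θ²)‖cᵐ − b^{m,2}‖². -/
open scoped RealInnerProductSpace
open Finset

/-- Young's inequality for the squared norm of a sum. -/
theorem norm_add_sq_le_young {E : Type*} [SeminormedAddCommGroup E] (x y : E) {ρ : ℝ}
    (hρ : 0 < ρ) : ‖x + y‖ ^ 2 ≤ (1 + ρ) * ‖x‖ ^ 2 + (1 + 1 / ρ) * ‖y‖ ^ 2 := by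
  have hsq : (‖x‖ + ‖y‖) ^ 2
      = (1 + ρ) * ‖x‖ ^ 2 + (1 + 1 / ρ) * ‖y‖ ^ 2 - (ρ * ‖x‖ - ‖y‖) ^ 2 / ρ := by
    field_simp
    ring
  have hnonneg : 0 ≤ (ρ * ‖x‖ - ‖y‖) ^ 2 / ρ := by positivity
  calc ‖x + y‖ ^ 2 ≤ (‖x‖ + ‖y‖) ^ 2 := by gcongr; exact norm_add_le x y
    _ ≤ _ := by linarith

/-- Recursive bound on the corrected-residual error: for every `m ≥ 0` and `ρ > 0`,
`‖c^{m+1} − b^{m+1,2}‖² ≤ (1+ρ)(1−Θ²)‖r^{m+1}‖² + (1+1/ρ)(1−Θ²)‖cᵐ − b^{m,2}‖²`. -/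
theorem agbm_corrected_residual_recursive_bound
    (n : ℕ) (hn : 1 ≤ n)
    (σ η γ Θ : ℝ)
    (hσ : 0 < σ) (hη0 : 0 < η) (hη : η ≤ 1 / σ)
    (hγ0 : 0 < γ) (hγ1 : γ ≤ 1) (hΘ0 : 0 < Θ) (hΘ1 : Θ ≤ 1)
    (w : EuclideanSpace ℝ (Fin n))
    (ℓ ℓ' : Fin n → ℝ → ℝ)
    (hderiv : ∀ i x, HasDerivAt (ℓ i) (ℓ' i x) x)
    (hconv : ∀ i, ConvexOn ℝ Set.univ (ℓ i))
    (hsmooth : ∀ i a b, ℓ i a ≤ ℓ i b + ℓ' i b * (a - b) + σ / 2 * (a - b) ^ 2)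
    (L : EuclideanSpace ℝ (Fin n) → ℝ)
    (hL : ∀ v, L v = ∑ i, ℓ i (v i))
    (θ : ℕ → ℝ)
    (hθ : ∀ m : ℕ, θ m = 2 / (m + 2))
    (f h g r b1 c b2 : ℕ → EuclideanSpace ℝ (Fin n))
    (hf0 : f 0 = w) (hh0 : h 0 = w)
    (hg : ∀ m, g m = (1 - θ m) • f m + θ m • h m)
    (hr : ∀ m i, r m i = -(ℓ' i (g m i)))
    (hb1 : ∀ m, ‖b1 m - r m‖ ^ 2 ≤ (1 - Θ ^ 2) * ‖r m‖ ^ 2)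
    (hfs : ∀ m, f (m + 1) = g m + η • b1 m)
    (hc0 : c 0 = r 0)
    (hcs : ∀ m, 1 ≤ m → c m = r m + (θ m / θ (m - 1)) • (c (m - 1) - b2 (m - 1)))
    (hb2 : ∀ m, ‖b2 m - c m‖ ^ 2 ≤ (1 - Θ ^ 2) * ‖c m‖ ^ 2)
    (hhs : ∀ m, h (m + 1) = h m + (η * γ / θ m) • b2 m)
    (m : ℕ) (ρ : ℝ) (hρ : 0 < ρ) :
    ‖c (m + 1) - b2 (m + 1)‖ ^ 2
      ≤ (1 + ρ) * (1 - Θ ^ 2) * ‖r (m + 1)‖ ^ 2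
        + (1 + 1 / ρ) * (1 - Θ ^ 2) * ‖c m - b2 m‖ ^ 2 := by
  have hstep : c (m + 1) = r (m + 1) + (θ (m + 1) / θ m) • (c m - b2 m) :=
    hcs (m + 1) (Nat.le_add_left 1 m)
  have hpos : ∀ k, 0 < θ k := fun k => by rw [hθ]; positivity
  have hratio_nonneg : 0 ≤ θ (m + 1) / θ m := (div_pos (hpos _) (hpos _)).le
  have hratio_le_one : θ (m + 1) / θ m ≤ 1 := by
    rw [div_le_one (hpos m), hθ, hθ]
    gcongr
    simp
  have hscaled : ‖(θ (m + 1) / θ m) • (c m - b2 m)‖ ≤ ‖c m - b2 m‖ := by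
    rw [norm_smul, Real.norm_of_nonneg hratio_nonneg]
    exact mul_le_of_le_one_left (norm_nonneg _) hratio_le_one
  have hfactor : 0 ≤ 1 - Θ ^ 2 := sub_nonneg.mpr (pow_le_one₀ hΘ0.le hΘ1)
  calc ‖c (m + 1) - b2 (m + 1)‖ ^ 2
      ≤ (1 - Θ ^ 2) * ‖c (m + 1)‖ ^ 2 := by rw [norm_sub_rev]; exact hb2 (m + 1)
    _ ≤ (1 - Θ ^ 2) * ((1 + ρ) * ‖r (m + 1)‖ ^ 2
          + (1 + 1 / ρ) * ‖(θ (m + 1) / θ m) • (c m - b2 m)‖ ^ 2) := by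
        rw [hstep]
        exact mul_le_mul_of_nonneg_left (norm_add_sq_le_young _ _ hρ) hfactor
    _ ≤ (1 - Θ ^ 2) * ((1 + ρ) * ‖r (m + 1)‖ ^ 2 + (1 + 1 / ρ) * ‖c m - b2 m‖ ^ 2) := by
        gcongr
    _ = _ := by ring
end

section
/- Let Θ ∈ (0,1], s ∈ (0, Θ²/(4+Θ²)], and t = (1−s)/2. Suppose (a_j)_{j≥0} and (c_j)_{j≥0} are nonnegative real sequences such that a_0 ≤ (1−Θ²)·c_0 and, for every j ≥ 0 and every ρ > 0, a_{j+1} ≤ (1−Θ²)·[(1+1/ρ)·a_j + (1+ρ)·c_{j+1}]. Then for every m ≥ 0: ∑_{j=0}^{m} a_j ≤ (t(1−s−t)/s²)·∑_{j=0}^{m} c_j. -/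
open scoped RealInnerProductSpace
open Finset

/-- If `a 0 ≤ β c 0` and `a (j + 1) ≤ α a j + β c (j + 1)`, then summing gives the same
recursion for the partial sums. -/
lemma sum_range_le_of_affine_recursion {a c : ℕ → ℝ} {α β : ℝ} (h0 : a 0 ≤ β * c 0)
    (hrec : ∀ j, a (j + 1) ≤ α * a j + β * c (j + 1)) (m : ℕ) :
    ∑ j ∈ Finset.range (m + 1), a j
      ≤ α * ∑ j ∈ Finset.range m, a j + β * ∑ j ∈ Finset.range (m + 1), c j := by
  induction m with
  | zero => simpa using h0
  | succ k ih =>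
    rw [Finset.sum_range_succ a (k + 1), Finset.sum_range_succ c (k + 1)]
    have hk := hrec k
    have hS := Finset.sum_range_succ a k
    rw [hS] at ih ⊢
    linarith

/-- Lemma C.6 (recursive sequence bound): for `Θ ∈ (0,1]`, `s ∈ (0, Θ²/(4+Θ²)]`,
`t = (1−s)/2`, and nonnegative sequences with `a_0 ≤ (1−Θ²)c_0` and
`a_{j+1} ≤ (1−Θ²)[(1+1/ρ)a_j + (1+ρ)c_{j+1}]` for all `ρ > 0`, one has
`∑_{j=0}^m a_j ≤ (t(1−s−t)/s²)·∑_{j=0}^m c_j`. -/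
theorem recursive_sequence_bound
    (Θ s t : ℝ) (hΘ0 : 0 < Θ) (hΘ1 : Θ ≤ 1)
    (hs0 : 0 < s) (hs : s ≤ Θ ^ 2 / (4 + Θ ^ 2)) (ht : t = (1 - s) / 2)
    (a c : ℕ → ℝ) (ha : ∀ j, 0 ≤ a j) (hc : ∀ j, 0 ≤ c j)
    (ha0 : a 0 ≤ (1 - Θ ^ 2) * c 0)
    (hrec : ∀ j : ℕ, ∀ ρ : ℝ, 0 < ρ →
      a (j + 1) ≤ (1 - Θ ^ 2) * ((1 + 1 / ρ) * a j + (1 + ρ) * c (j + 1)))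
    (m : ℕ) :
    ∑ j ∈ Finset.range (m + 1), a j
      ≤ t * (1 - s - t) / s ^ 2 * ∑ j ∈ Finset.range (m + 1), c j := by
  have hx0 : 0 < Θ ^ 2 := by positivity
  have hx1 : Θ ^ 2 ≤ 1 := by nlinarith
  generalize Θ ^ 2 = x at *
  have hsum := sum_range_le_of_affine_recursion (a := a) (c := c)
    (α := (1 - x) * (1 + x / 2)) (β := (1 - x) * (1 + 2 / x))
    (ha0.trans (mul_le_mul_of_nonneg_right
      (le_mul_of_one_le_right (by linarith) (by linarith [div_pos two_pos hx0])) (hc 0)))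
    (fun j => (hrec j (2 / x) (by positivity)).trans_eq (by rw [one_div_div]; ring)) m
  have hmono : ∑ j ∈ Finset.range m, a j ≤ ∑ j ∈ Finset.range (m + 1), a j := by
    rw [Finset.sum_range_succ]
    linarith [ha m]
  have hA : 0 ≤ ∑ j ∈ Finset.range (m + 1), a j := Finset.sum_nonneg fun j _ => ha j
  have hC : 0 ≤ ∑ j ∈ Finset.range (m + 1), c j := Finset.sum_nonneg fun j _ => hc j
  generalize ∑ j ∈ Finset.range (m + 1), a j = A at *
  generalize ∑ j ∈ Finset.range (m + 1), c j = C at *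
  have hα : 0 ≤ (1 - x) * (1 + x / 2) := mul_nonneg (by linarith) (by linarith)
  have hself := hsum.trans (add_le_add_left (mul_le_mul_of_nonneg_left hmono hα) _)
  have hcoef : (1 - x) * (1 + 2 / x) ≤ x * (1 + x) / 2 * (2 / x) ^ 2 := by
    field_simp
    nlinarith
  have hAC : A ≤ (2 / x) ^ 2 * C := by
    refine le_of_mul_le_mul_left ?_ (show 0 < x * (1 + x) / 2 by positivity)
    linarith [mul_le_mul_of_nonneg_right hcoef hC]
  refine hAC.trans (mul_le_mul_of_nonneg_right ?_ hC)
  have hratio : 2 / x ≤ (1 - s) / (2 * s) := by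
    rw [le_div_iff₀ (by positivity)] at hs
    rw [div_le_div_iff₀ hx0 (by positivity)]
    linarith
  calc (2 / x) ^ 2 ≤ ((1 - s) / (2 * s)) ^ 2 := by gcongr
    _ = t * (1 - s - t) / s ^ 2 := by
      rw [ht]
      field_simp
      ring
end

section
/- Let Θ ∈ (0,1). Suppose (a_j)_{j≥0} and (c_j)_{j≥0} are nonnegative real sequences such that a_0 ≤ (1−Θ²)·c_0 and, for every j ≥ 0 and every ρ > 0, a_{j+1} ≤ (1−Θ²)·[(1+1/ρ)·a_j + (1+ρ)·c_{j+1}]. Then for every m ≥ 0: ∑_{j=0}^{m} a_j ≤ (2(2−Θ²)(1−Θ²)/Θ⁴)·∑_{k=0}^{m} c_k. -/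
open scoped RealInnerProductSpace
open Finset

/-- A sequence with `a_0 ≤ B c_0` and `a_{j+1} ≤ q a_j + B c_{j+1}` satisfies
`(1 - q) ∑_{j ≤ m} a_j + q a_m ≤ B ∑_{k ≤ m} c_k`. -/
theorem sum_add_le_of_le_linear_recursion {q B : ℝ} {a c : ℕ → ℝ}
    (h0 : a 0 ≤ B * c 0) (hstep : ∀ j, a (j + 1) ≤ q * a j + B * c (j + 1)) (m : ℕ) :
    (1 - q) * ∑ j ∈ Finset.range (m + 1), a j + q * a m
      ≤ B * ∑ k ∈ Finset.range (m + 1), c k := by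
  induction m with
  | zero =>
    simp only [zero_add, Finset.sum_range_one]
    linarith
  | succ m ih =>
    rw [Finset.sum_range_succ _ (m + 1), Finset.sum_range_succ _ (m + 1)]
    linarith [hstep m]

/-- Unrolled recursive sequence bound: for `Θ ∈ (0,1)` and nonnegative sequences with
`a_0 ≤ (1−Θ²)c_0` and `a_{j+1} ≤ (1−Θ²)[(1+1/ρ)a_j + (1+ρ)c_{j+1}]` for all `ρ > 0`,
`∑_{j=0}^m a_j ≤ (2(2−Θ²)(1−Θ²)/Θ⁴)·∑_{k=0}^m c_k`. -/
theorem recursive_sequence_bound_unrolled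
    (Θ : ℝ) (hΘ0 : 0 < Θ) (hΘ1 : Θ < 1)
    (a c : ℕ → ℝ) (ha : ∀ j, 0 ≤ a j) (hc : ∀ j, 0 ≤ c j)
    (ha0 : a 0 ≤ (1 - Θ ^ 2) * c 0)
    (hrec : ∀ j : ℕ, ∀ ρ : ℝ, 0 < ρ →
      a (j + 1) ≤ (1 - Θ ^ 2) * ((1 + 1 / ρ) * a j + (1 + ρ) * c (j + 1)))
    (m : ℕ) :
    ∑ j ∈ Finset.range (m + 1), a j
      ≤ 2 * (2 - Θ ^ 2) * (1 - Θ ^ 2) / Θ ^ 4 * ∑ k ∈ Finset.range (m + 1), c k := by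
  have ht0 : 0 < Θ ^ 2 := by positivity
  have ht1 : Θ ^ 2 < 1 := by nlinarith
  rw [show Θ ^ 4 = (Θ ^ 2) ^ 2 by ring]
  generalize Θ ^ 2 = t at *
  have hu : 0 < 1 - t := sub_pos.2 ht1
  have h0 : a 0 ≤ (1 - t) * (2 - t) / t * c 0 := by
    refine ha0.trans (mul_le_mul_of_nonneg_right ?_ (hc 0))
    rw [le_div_iff₀ ht0]
    nlinarith
  have hstep : ∀ j, a (j + 1) ≤ (1 - t / 2) * a j + (1 - t) * (2 - t) / t * c (j + 1) := by
    intro j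
    refine (hrec j (2 * (1 - t) / t) (by positivity)).trans_eq ?_
    have := hu.ne'
    field_simp
    ring
  have hsum := sum_add_le_of_le_linear_recursion h0 hstep m
  have hlast : 0 ≤ (1 - t / 2) * a m := mul_nonneg (by linarith) (ha m)
  calc ∑ j ∈ Finset.range (m + 1), a j
      = 2 / t * ((1 - (1 - t / 2)) * ∑ j ∈ Finset.range (m + 1), a j) := by
        field_simp
        ring
    _ ≤ 2 / t * ((1 - t) * (2 - t) / t * ∑ k ∈ Finset.range (m + 1), c k) :=
        mul_le_mul_of_nonneg_left (by linarith) (by positivity)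
    _ = 2 * (2 - t) * (1 - t) / t ^ 2 * ∑ k ∈ Finset.range (m + 1), c k := by
        field_simp
end
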